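/- arXiv:1905.06062 — 2 statements merged into one kernel-verified Lean document; each statement's English description precedes it below -/
import Mathlib

section
/- If λ is a regular cardinal, M is a λ-closed transitive class, and j : M → M is a nontrivial elementary embedding with critical point κ ≤ λ, then λ^{<κ} = λ. -/
open FirstOrder FirstOrder.Language

/-- The language of set theory: one binary relation symbol. -/
def ZFLang : FirstOrder.Language :=
  ⟨fun _ => Empty, fun n => match n with | 2 => Unit | _ => Empty⟩

def memRel : ZFLang.Relations 2 := ()

/-- The membership structure on a class of ZF-sets. -/
noncomputable instance zfStr (M : Set ZFSet) : ZFLang.Structure ↥M where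
  funMap {n} f _ := f.elim
  RelMap {n} r v :=
    match n, r, v with
    | 2, _, v => ((v 0 : ↥M) : ZFSet) ∈ ((v 1 : ↥M) : ZFSet)
    | 0, r, _ => r.elim
    | 1, r, _ => r.elim
    | (_+3), r, _ => r.elim

/-- The formula `x ∈ y`. -/
def mem' {n : ℕ} (x y : Fin n) : ZFLang.BoundedFormula Empty n :=
  Relations.boundedFormula₂ memRel (Term.var (Sum.inr x)) (Term.var (Sum.inr y))

/-- The formula `x = y`. -/
def eq' {n : ℕ} (x y : Fin n) : ZFLang.BoundedFormula Empty n :=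
  Term.bdEqual (Term.var (Sum.inr x)) (Term.var (Sum.inr y))

def extAx : ZFLang.Sentence :=
  ∀' ∀' ((∀' (mem' 2 0 ⇔ mem' 2 1)) ⟹ eq' 0 1)

def pairAx : ZFLang.Sentence :=
  ∀' ∀' ∃' ∀' (mem' 3 2 ⇔ (eq' 3 0 ⊔ eq' 3 1))

def unionAx : ZFLang.Sentence :=
  ∀' ∃' ∀' (mem' 2 1 ⇔ ∃' (mem' 3 0 ⊓ mem' 2 3))

def powerAx : ZFLang.Sentence :=
  ∀' ∃' ∀' (mem' 2 1 ⇔ ∀' (mem' 3 2 ⟹ mem' 3 0))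

def infAx : ZFLang.Sentence :=
  ∃' ((∃' (mem' 1 0 ⊓ ∀' (∼(mem' 2 1)))) ⊓
    (∀' (mem' 1 0 ⟹ ∃' (mem' 2 0 ⊓ ∀' (mem' 3 2 ⇔ (mem' 3 1 ⊔ eq' 3 1))))))

def foundAx : ZFLang.Sentence :=
  ∀' ((∃' (mem' 1 0)) ⟹ ∃' (mem' 1 0 ⊓ ∀' (mem' 2 1 ⟹ ∼(mem' 2 0))))

/-- The separation axiom for a formula with `k` parameters. -/
def sepAx {k : ℕ} (φ : ZFLang.BoundedFormula Empty (k + 1)) : ZFLang.Sentence :=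
  (mem' ⟨k+2, by omega⟩ ⟨k+1, by omega⟩ ⇔
      (mem' ⟨k+2, by omega⟩ ⟨k, by omega⟩ ⊓ φ.liftAt 2 k)).all.ex.all.alls

/-- The collection axiom for a formula with `k` parameters. -/
def collAx {k : ℕ} (φ : ZFLang.BoundedFormula Empty (k + 2)) : ZFLang.Sentence :=
  (mem' ⟨k+2, by omega⟩ ⟨k, by omega⟩ ⟹
      ((φ.liftAt 2 k).ex ⟹
        ((mem' ⟨k+3, by omega⟩ ⟨k+1, by omega⟩ ⊓ φ.liftAt 2 k).ex))).all.ex.all.alls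

def choiceAx : ZFLang.Sentence :=
  (((∀' ((mem' 1 0) ⟹ (∃' (mem' 2 1)))) ⊓
    (∀' ∀' ((((mem' 1 0) ⊓ (mem' 2 0)) ⊓ (∼(eq' 1 2))) ⟹ (∀' (∼((mem' 3 1) ⊓ (mem' 3 2)))))))
   ⟹
   (∃' ∀' ((mem' 2 0) ⟹
      (∃' (((mem' 3 2) ⊓ (mem' 3 1)) ⊓
        (∀' (((mem' 4 2) ⊓ (mem' 4 1)) ⟹ (eq' 4 3)))))))).all

/-- The ZFC axioms: extensionality, pairing, union, powerset, infinity, foundation, choice,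
separation, and collection. -/
def ZFCTheory : ZFLang.Theory :=
  {extAx, pairAx, unionAx, powerAx, infAx, foundAx, choiceAx} ∪
    (⋃ (k : ℕ), Set.range (@sepAx k)) ∪ (⋃ (k : ℕ), Set.range (@collAx k))

/-- A class of ZF-sets is transitive. -/
def SetTransitive (M : Set ZFSet) : Prop := ∀ x ∈ M, ∀ y : ZFSet, y ∈ x → y ∈ M

/-- A transitive model of ZFC. -/
def IsZFCModel (M : Set ZFSet) : Prop := SetTransitive M ∧ ZFCTheory.Model ↥M

/-- Two classes have the same ordinals. -/
def SameOrdinals (M N : Set ZFSet) : Prop :=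
  ∀ x : ZFSet, x.IsOrdinal → (x ∈ M ↔ x ∈ N)

/-- `z` is the pointwise image `j[x]` of `x` under `j`. -/
def ImageSet (M N : Set ZFSet) (j : ↥M → ↥N) (x z : ZFSet) : Prop :=
  ∀ w : ZFSet, w ∈ z ↔ ∃ y : ↥M, (y : ZFSet) ∈ x ∧ ((j y : ↥N) : ZFSet) = w

/-- `j : M → N` is amenable: every pointwise image `j[x]`, `x ∈ M`, belongs to `N`. -/
def Amenable (M N : Set ZFSet) (j : ↥M → ↥N) : Prop :=
  ∀ x ∈ M, ∃ z ∈ N, ImageSet M N j x z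

/-- `κ` is the critical point of `j`: the least ordinal moved. -/
def IsCrit (M N : Set ZFSet) (j : ↥M → ↥N) (κ : ZFSet) : Prop :=
  κ.IsOrdinal ∧ ∃ h : κ ∈ M, ((j ⟨κ, h⟩ : ↥N) : ZFSet) ≠ κ ∧
    ∀ β : ZFSet, β ∈ κ → ∀ hb : β ∈ M, ((j ⟨β, hb⟩ : ↥N) : ZFSet) = β

/-- `f` is a cofinal map from `β` into the ordinal `α`. -/
def CofinalIn (β α f : ZFSet) : Prop :=
  ∀ γ, γ ∈ α → ∃ ξ, ξ ∈ β ∧ ∃ η, ξ.pair η ∈ f ∧ (γ ∈ η ∨ γ = η)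

/-- `α` is a regular ordinal from the point of view of the class `M`. -/
def RegularIn (M : Set ZFSet) (α : ZFSet) : Prop :=
  ∀ β, β ∈ α → ∀ f, f ∈ M → ZFSet.IsFunc β α f → ¬ CofinalIn β α f

/-- An injective ZF-function from `a` to `b`. -/
def InjZFunc (a b f : ZFSet) : Prop :=
  ZFSet.IsFunc a b f ∧ ∀ x y z : ZFSet, x.pair z ∈ f → y.pair z ∈ f → x = y

/-- `λ` is a regular (infinite) cardinal in `V`. -/
def RegularCard (lam : ZFSet) : Prop :=
  lam.IsOrdinal ∧ (ZFSet.omega ∈ lam ∨ ZFSet.omega = lam) ∧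
    (∀ β, β ∈ lam → ¬ ∃ f, InjZFunc lam β f) ∧
    ∀ β, β ∈ lam → ∀ f, ZFSet.IsFunc β lam f → ¬ CofinalIn β lam f

/-- The class `M` is `λ`-closed: every `λ`-sequence of elements of `M` lies in `M`
(as a coded graph). -/
def LambdaClosed (lam : ZFSet) (M : Set ZFSet) : Prop :=
  ∀ F : ZFSet → ZFSet, (∀ x, x ∈ lam → F x ∈ M) →
    ∃ f ∈ M, (∀ a, a ∈ lam → a.pair (F a) ∈ f) ∧
      ∀ p ∈ f, ∃ a, a ∈ lam ∧ p = a.pair (F a)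

/-- `P_κ(λ)`: the set of subsets of `λ` of size less than `κ`. -/
noncomputable def SmallSubsets (κ lam : ZFSet) : ZFSet :=
  ZFSet.sep (fun s => ∃ β, β ∈ κ ∧ ∃ f, InjZFunc s β f) (ZFSet.powerset lam)

/-- `a` and `b` are equinumerous (via a ZF-coded bijection). -/
def Equinumerous (a b : ZFSet) : Prop :=
  ∃ f, ZFSet.IsFunc a b f ∧ (∀ x y z : ZFSet, x.pair z ∈ f → y.pair z ∈ f → x = y) ∧
    ∀ w, w ∈ b → ∃ u : ZFSet, u.pair w ∈ f

/-- `P` is first-order definable without parameters over the structure `(M, ∈)`. -/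
class Dfn {M : Set ZFSet} {n : ℕ} (P : (Fin n → ↥M) → Prop) : Prop where
  out : ∃ φ : ZFLang.BoundedFormula Empty n, ∀ v : Fin n → ↥M, φ.Realize default v ↔ P v

namespace Dfn

variable {M : Set ZFSet} {n : ℕ}

instance mem (i k : Fin n) : Dfn (M := M) fun v => (v i).1 ∈ (v k).1 :=
  ⟨mem' i k, fun v => by
    simp [mem', memRel]
    rfl⟩

instance eq (i k : Fin n) : Dfn (M := M) fun v => v i = v k :=
  ⟨eq' i k, fun v => by simp [eq']⟩

instance and (P Q : (Fin n → ↥M) → Prop) [Dfn P] [Dfn Q] : Dfn fun v => P v ∧ Q v := by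
  obtain ⟨φ, hφ⟩ := Dfn.out (P := P)
  obtain ⟨ψ, hψ⟩ := Dfn.out (P := Q)
  exact ⟨φ ⊓ ψ, by simp [hφ, hψ]⟩

instance or (P Q : (Fin n → ↥M) → Prop) [Dfn P] [Dfn Q] : Dfn fun v => P v ∨ Q v := by
  obtain ⟨φ, hφ⟩ := Dfn.out (P := P)
  obtain ⟨ψ, hψ⟩ := Dfn.out (P := Q)
  exact ⟨φ ⊔ ψ, by simp [hφ, hψ]⟩

instance imp (P Q : (Fin n → ↥M) → Prop) [Dfn P] [Dfn Q] : Dfn fun v => P v → Q v := by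
  obtain ⟨φ, hφ⟩ := Dfn.out (P := P)
  obtain ⟨ψ, hψ⟩ := Dfn.out (P := Q)
  exact ⟨φ.imp ψ, by simp [hφ, hψ]⟩

instance iff (P Q : (Fin n → ↥M) → Prop) [Dfn P] [Dfn Q] : Dfn fun v => P v ↔ Q v := by
  obtain ⟨φ, hφ⟩ := Dfn.out (P := P)
  obtain ⟨ψ, hψ⟩ := Dfn.out (P := Q)
  exact ⟨φ.iff ψ, by simp [hφ, hψ]⟩

instance not (P : (Fin n → ↥M) → Prop) [Dfn P] : Dfn fun v => ¬ P v := by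
  obtain ⟨φ, hφ⟩ := Dfn.out (P := P)
  exact ⟨∼φ, by simp [hφ]⟩

instance all (P : (Fin n → ↥M) → ↥M → Prop)
    [h : Dfn fun v : Fin (n + 1) → ↥M => P (fun i => v i.castSucc) (v (Fin.last n))] :
    Dfn fun v => ∀ x, P v x := by
  obtain ⟨φ, hφ⟩ := h.out
  exact ⟨φ.all, by simp [hφ]⟩

instance ex (P : (Fin n → ↥M) → ↥M → Prop)
    [h : Dfn fun v : Fin (n + 1) → ↥M => P (fun i => v i.castSucc) (v (Fin.last n))] :
    Dfn fun v => ∃ x, P v x := by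
  obtain ⟨φ, hφ⟩ := h.out
  exact ⟨φ.ex, by simp [hφ]⟩

/-- Elementary embeddings preserve definable predicates. -/
theorem map_iff (j : ↥M ↪ₑ[ZFLang] ↥M) (P : (Fin n → ↥M) → Prop) [h : Dfn P]
    (v : Fin n → ↥M) : P (fun i => j (v i)) ↔ P v := by
  obtain ⟨φ, hφ⟩ := h.out
  rw [← hφ, ← hφ, ← j.map_boundedFormula φ default v]
  exact iff_of_eq (congrArg₂ _ (Subsingleton.elim _ _) rfl)

end Dfn

section Transfer

variable {M : Set ZFSet} (j : ↥M ↪ₑ[ZFLang] ↥M)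

theorem transfer₁ (P : ↥M → Prop) [Dfn fun v : Fin 1 → ↥M => P (v 0)] (a : ↥M) :
    P (j a) ↔ P a :=
  Dfn.map_iff j (fun v : Fin 1 → ↥M => P (v 0)) ![a]

theorem transfer₂ (P : ↥M → ↥M → Prop) [Dfn fun v : Fin 2 → ↥M => P (v 0) (v 1)] (a b : ↥M) :
    P (j a) (j b) ↔ P a b :=
  Dfn.map_iff j (fun v : Fin 2 → ↥M => P (v 0) (v 1)) ![a, b]

theorem transfer₃ (P : ↥M → ↥M → ↥M → Prop)
    [Dfn fun v : Fin 3 → ↥M => P (v 0) (v 1) (v 2)] (a b c : ↥M) :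
    P (j a) (j b) (j c) ↔ P a b c :=
  Dfn.map_iff j (fun v : Fin 3 → ↥M => P (v 0) (v 1) (v 2)) ![a, b, c]

theorem transfer₄ (P : ↥M → ↥M → ↥M → ↥M → Prop)
    [Dfn fun v : Fin 4 → ↥M => P (v 0) (v 1) (v 2) (v 3)] (a b c d : ↥M) :
    P (j a) (j b) (j c) (j d) ↔ P a b c d :=
  Dfn.map_iff j (fun v : Fin 4 → ↥M => P (v 0) (v 1) (v 2) (v 3)) ![a, b, c, d]

theorem transfer₅ (P : ↥M → ↥M → ↥M → ↥M → ↥M → Prop)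
    [Dfn fun v : Fin 5 → ↥M => P (v 0) (v 1) (v 2) (v 3) (v 4)] (a b c d e : ↥M) :
    P (j a) (j b) (j c) (j d) (j e) ↔ P a b c d e :=
  Dfn.map_iff j (fun v : Fin 5 → ↥M => P (v 0) (v 1) (v 2) (v 3) (v 4)) ![a, b, c, d, e]

theorem transfer₆ (P : ↥M → ↥M → ↥M → ↥M → ↥M → ↥M → Prop)
    [Dfn fun v : Fin 6 → ↥M => P (v 0) (v 1) (v 2) (v 3) (v 4) (v 5)] (a b c d e f : ↥M) :
    P (j a) (j b) (j c) (j d) (j e) (j f) ↔ P a b c d e f :=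
  Dfn.map_iff j (fun v : Fin 6 → ↥M => P (v 0) (v 1) (v 2) (v 3) (v 4) (v 5)) ![a, b, c, d, e, f]

theorem transfer₇ (P : ↥M → ↥M → ↥M → ↥M → ↥M → ↥M → ↥M → Prop)
    [Dfn fun v : Fin 7 → ↥M => P (v 0) (v 1) (v 2) (v 3) (v 4) (v 5) (v 6)]
    (a b c d e f g : ↥M) :
    P (j a) (j b) (j c) (j d) (j e) (j f) (j g) ↔ P a b c d e f g :=
  Dfn.map_iff j (fun v : Fin 7 → ↥M => P (v 0) (v 1) (v 2) (v 3) (v 4) (v 5) (v 6))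
    ![a, b, c, d, e, f, g]

theorem map_mem_iff (a b : ↥M) : (j a).1 ∈ (j b).1 ↔ a.1 ∈ b.1 :=
  transfer₂ j (fun x y => x.1 ∈ y.1) a b

end Transfer

section Sequences

variable {M : Set ZFSet}

/-- `App f x y` says, inside `M`, that the ordered pair of `x` and `y` belongs to `f`. -/
def App (f x y : ↥M) : Prop :=
  ∃ p u v : ↥M, p.1 ∈ f.1 ∧ (∀ z : ↥M, z.1 ∈ p.1 ↔ z = u ∨ z = v) ∧
    (∀ z : ↥M, z.1 ∈ u.1 ↔ z = x) ∧ ∀ z : ↥M, z.1 ∈ v.1 ↔ z = x ∨ z = y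

instance Dfn.app {n : ℕ} (i k l : Fin n) : Dfn (M := M) fun v => App (v i) (v k) (v l) := by
  unfold App
  infer_instance

theorem app_map_iff (j : ↥M ↪ₑ[ZFLang] ↥M) (f x y : ↥M) :
    App (j f) (j x) (j y) ↔ App f x y :=
  transfer₃ j App f x y

theorem ext_of_transitive (hT : SetTransitive M) {x : ↥M} {y : ZFSet} (hy : ∀ z ∈ y, z ∈ M)
    (h : ∀ z : ↥M, z.1 ∈ x.1 ↔ z.1 ∈ y) : x.1 = y := by
  ext z
  exact ⟨fun hz => (h ⟨z, hT _ x.2 _ hz⟩).1 hz, fun hz => (h ⟨z, hy z hz⟩).2 hz⟩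

theorem app_iff (hT : SetTransitive M) (f x y : ↥M) : App f x y ↔ x.1.pair y.1 ∈ f.1 := by
  constructor
  · rintro ⟨p, u, v, hp, hpu, hu, hv⟩
    have hu' : u.1 = {x.1} := ext_of_transitive hT (by simp) (by simp [hu, Subtype.ext_iff])
    have hv' : v.1 = {x.1, y.1} :=
      ext_of_transitive hT (by simp) (by simp [hv, Subtype.ext_iff])
    have hp' : p.1 = {u.1, v.1} :=
      ext_of_transitive hT (by simp) (by simp [hpu, Subtype.ext_iff])
    rw [hu', hv'] at hp'
    rw [ZFSet.pair, ← hp']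
    exact hp
  · intro h
    have hp : x.1.pair y.1 ∈ M := hT _ f.2 _ h
    have hu : ({x.1} : ZFSet) ∈ M := hT _ hp _ (by simp [ZFSet.pair])
    have hv : ({x.1, y.1} : ZFSet) ∈ M := hT _ hp _ (by simp [ZFSet.pair])
    exact ⟨⟨_, hp⟩, ⟨_, hu⟩, ⟨_, hv⟩, h, by simp [ZFSet.pair, Subtype.ext_iff],
      by simp [Subtype.ext_iff], by simp [Subtype.ext_iff]⟩

/-- Every function on `L` with values in `M` is coded by an element of `M`. -/
def SeqClosed (L : ↥M) : Prop :=
  ∀ F : ↥M → ↥M, ∃ f : ↥M, ∀ a b : ↥M, App f a b ↔ a.1 ∈ L.1 ∧ b = F a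

theorem LambdaClosed.seqClosed (hT : SetTransitive M) {L : ↥M} (h : LambdaClosed L.1 M) :
    SeqClosed L := by
  classical
  intro F
  obtain ⟨f, hf, h₁, h₂⟩ := h (fun x => if hx : x ∈ M then (F ⟨x, hx⟩).1 else ∅) (fun x hx => by
    simp [hT _ L.2 _ hx])
  refine ⟨⟨f, hf⟩, fun a b => ?_⟩
  rw [app_iff hT]
  constructor
  · intro hab
    obtain ⟨a', ha', he⟩ := h₂ _ hab
    obtain ⟨rfl, hb⟩ := ZFSet.pair_injective he
    exact ⟨ha', Subtype.ext (by simpa using hb)⟩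
  · rintro ⟨ha, rfl⟩
    simpa using h₁ _ ha

/-- The value at `(x, y)` of the sequence of sequences `f` is `z`. -/
def App₂ (f x y z : ↥M) : Prop :=
  ∃ g, App f x g ∧ App g y z

instance Dfn.app₂ {n : ℕ} (i k l m : Fin n) :
    Dfn (M := M) fun v => App₂ (v i) (v k) (v l) (v m) := by
  unfold App₂
  infer_instance

theorem app₂_map_iff (j : ↥M ↪ₑ[ZFLang] ↥M) (f x y z : ↥M) :
    App₂ (j f) (j x) (j y) (j z) ↔ App₂ f x y z :=
  transfer₄ j App₂ f x y z

theorem SeqClosed.exists_app₂ {L : ↥M} (h : SeqClosed L) (F : ↥M → ↥M → ↥M) :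
    ∃ f : ↥M, ∀ a b c : ↥M, App₂ f a b c ↔ a.1 ∈ L.1 ∧ b.1 ∈ L.1 ∧ c = F a b := by
  choose g hg using fun a => h (F a)
  obtain ⟨f, hf⟩ := h g
  exact ⟨f, fun a b c => ⟨fun ⟨g', h₁, h₂⟩ => by
    obtain ⟨ha, rfl⟩ := (hf _ _).1 h₁
    exact ⟨ha, (hg _ _ _).1 h₂⟩,
    fun ⟨ha, hbc⟩ => ⟨g a, (hf _ _).2 ⟨ha, rfl⟩, (hg _ _ _).2 hbc⟩⟩⟩

end Sequences

universe u

section Crit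

variable {M : Set ZFSet.{u}}

/-- `x` is an ordinal, as expressed inside `M`. -/
def OrdIn (x : ↥M) : Prop :=
  (∀ y z : ↥M, y.1 ∈ x.1 → z.1 ∈ y.1 → z.1 ∈ x.1) ∧
    ∀ y z w : ↥M, y.1 ∈ z.1 → z.1 ∈ w.1 → w.1 ∈ x.1 → y.1 ∈ w.1

theorem ordIn_iff (hT : SetTransitive M) (x : ↥M) : OrdIn x ↔ x.1.IsOrdinal := by
  constructor
  · rintro ⟨h₁, h₂⟩
    refine ⟨fun y hy z hz => ?_, fun {y z w} hy hz hw => ?_⟩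
    · have hyM := hT _ x.2 _ hy
      exact h₁ ⟨y, hyM⟩ ⟨z, hT _ hyM _ hz⟩ hy hz
    · have hwM := hT _ x.2 _ hw
      have hzM := hT _ hwM _ hz
      exact h₂ ⟨y, hT _ hzM _ hy⟩ ⟨z, hzM⟩ ⟨w, hwM⟩ hy hz hw
  · intro h
    exact ⟨fun y z hy hz => h.mem_trans hz hy,
      fun y z w hy hz hw => (h.mem hw).mem_trans hy hz⟩

theorem isOrdinal_map (hT : SetTransitive M) (j : ↥M ↪ₑ[ZFLang] ↥M) {x : ↥M}
    (hx : x.1.IsOrdinal) : (j x).1.IsOrdinal := by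
  rw [← ordIn_iff hT] at hx ⊢
  exact (transfer₁ j (fun x => (∀ y z : ↥M, y.1 ∈ x.1 → z.1 ∈ y.1 → z.1 ∈ x.1) ∧
    ∀ y z w : ↥M, y.1 ∈ z.1 → z.1 ∈ w.1 → w.1 ∈ x.1 → y.1 ∈ w.1) x).2 hx

/-- `j` fixes every element of the ordinal `κ` and moves `κ` up. -/
structure Moves (j : ↥M ↪ₑ[ZFLang] ↥M) (κ : ↥M) : Prop where
  isOrdinal : κ.1.IsOrdinal
  fix : ∀ β : ↥M, β.1 ∈ κ.1 → j β = β
  mem_map : κ.1 ∈ (j κ).1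

theorem IsCrit.moves (hT : SetTransitive M) {j : ↥M ↪ₑ[ZFLang] ↥M} {κ : ZFSet}
    (h : IsCrit M M j κ) : ∃ hκ : κ ∈ M, Moves j ⟨κ, hκ⟩ := by
  obtain ⟨ho, hκ, hne, hfix⟩ := h
  have hfix' : ∀ β : ↥M, β.1 ∈ κ → j β = β := fun β hβ => Subtype.ext (hfix β.1 hβ β.2)
  refine ⟨hκ, ho, hfix', ?_⟩
  have hsub : κ ⊆ (j ⟨κ, hκ⟩).1 := fun β hβ => by
    have := (map_mem_iff j ⟨β, hT _ hκ _ hβ⟩ ⟨κ, hκ⟩).2 hβ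
    rwa [hfix' ⟨β, hT _ hκ _ hβ⟩ hβ] at this
  rcases (ho.subset_iff_eq_or_mem (isOrdinal_map hT j (x := ⟨κ, hκ⟩) ho)).1 hsub with h | h
  · exact absurd h.symm hne
  · exact h

theorem Moves.omega_mem (hT : SetTransitive M) {j : ↥M ↪ₑ[ZFLang] ↥M} {κ : ↥M}
    (h : Moves j κ) : Ordinal.omega0.toZFSet ∈ κ.1 := by
  by_contra hω
  have hle : κ.1.rank ≤ Ordinal.omega0 := by
    rw [← not_lt, ← Ordinal.toZFSet_mem_toZFSet_iff, h.isOrdinal.toZFSet_rank_eq]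
    exact hω
  have key : ∀ β : ↥M, β.1 ∈ κ.1 → (∀ z : ↥M, ¬ z.1 ∈ β.1) ∨
      ∃ δ : ↥M, ∀ z : ↥M, z.1 ∈ β.1 ↔ z.1 ∈ δ.1 ∨ z = δ := by
    intro β hβ
    rw [← h.isOrdinal.toZFSet_rank_eq, Ordinal.mem_toZFSet_iff] at hβ
    obtain ⟨a, ha, hβ⟩ := hβ
    obtain ⟨n, rfl⟩ := Ordinal.lt_omega0.1 (ha.trans_le hle)
    cases n with
    | zero => left; simp [← hβ]
    | succ n =>
      right
      have hs : β.1 = insert (n : Ordinal).toZFSet (n : Ordinal).toZFSet := by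
        rw [← hβ, ← Ordinal.toZFSet_add_one]
        simp
      refine ⟨⟨(n : Ordinal).toZFSet, hT _ β.2 _ (by simp [hs])⟩, fun z => ?_⟩
      have hz : z.1 ∈ β.1 ↔ z.1 = (n : Ordinal).toZFSet ∨ z.1 ∈ (n : Ordinal).toZFSet := by
        rw [hs, ZFSet.mem_insert_iff]
      rw [hz, Subtype.ext_iff]
      exact or_comm
  have key' := (transfer₁ j (fun κ => ∀ β : ↥M, β.1 ∈ κ.1 → (∀ z : ↥M, ¬ z.1 ∈ β.1) ∨
      ∃ δ : ↥M, ∀ z : ↥M, z.1 ∈ β.1 ↔ z.1 ∈ δ.1 ∨ z = δ) κ).2 key κ h.mem_map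
  rcases key' with h0 | ⟨δ, hδ⟩
  · exact (transfer₁ j (fun κ => ∀ z : ↥M, ¬ z.1 ∈ κ.1) κ).2 h0 κ h.mem_map
  · have hδκ : δ.1 ∈ κ.1 := (hδ δ).2 (Or.inr rfl)
    have := (transfer₂ j (fun κ δ => ∀ z : ↥M, z.1 ∈ κ.1 ↔ z.1 ∈ δ.1 ∨ z = δ) κ δ).2 hδ κ
    rw [h.fix δ hδκ] at this
    rcases this.1 h.mem_map with h1 | h1
    · exact ZFSet.mem_asymm hδκ h1
    · rw [h1] at hδκ
      exact ZFSet.mem_irrefl _ hδκ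

theorem empty_mem_omega : (∅ : ZFSet) ∈ Ordinal.omega0.toZFSet := by
  rw [← Ordinal.toZFSet_zero, Ordinal.toZFSet_mem_toZFSet_iff]
  exact Ordinal.omega0_pos

theorem Moves.empty_mem (hT : SetTransitive M) {j : ↥M ↪ₑ[ZFLang] ↥M} {κ : ↥M}
    (h : Moves j κ) : (∅ : ZFSet) ∈ κ.1 := by
  exact h.isOrdinal.mem_trans empty_mem_omega (h.omega_mem hT)

open Cardinal in
theorem mk_subtype_mem (hT : SetTransitive M) (a : ↥M) :
    #{x : ↥M // x.1 ∈ a.1} = Cardinal.lift.{u + 1, u} a.1.card := by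
  rw [← ZFSet.cardinalMk_coe_sort]
  exact Cardinal.mk_congr ⟨fun x => ⟨x.1.1, x.2⟩, fun x => ⟨⟨x.1, hT _ a.2 _ x.2⟩, x.2⟩,
    fun _ => rfl, fun _ => rfl⟩

open Cardinal in
/-- A critical point is a strong limit. -/
theorem Moves.two_power_card_lt (hT : SetTransitive M) {j : ↥M ↪ₑ[ZFLang] ↥M} {κ L : ↥M}
    (h : Moves j κ) (hL : SeqClosed L) (hκL : κ.1 ⊆ L.1) {β : ↥M} (hβ : β.1 ∈ κ.1) :
    2 ^ β.1.card < κ.1.card := by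
  classical
  rw [← Cardinal.lift_lt.{u, u + 1}, Cardinal.lift_two_power, ← mk_subtype_mem hT,
    ← mk_subtype_mem hT, ← Cardinal.mk_set]
  by_contra hlt
  rw [not_lt, Cardinal.le_def] at hlt
  obtain ⟨G⟩ := hlt
  let zero : ↥M := ⟨∅, hT _ κ.2 _ (h.empty_mem hT)⟩
  let one : ↥M := ⟨_, hT _ κ.2 _ (h.omega_mem hT)⟩
  have h01 : zero ≠ one := by
    intro he
    have : (∅ : ZFSet) = Ordinal.omega0.toZFSet := congrArg Subtype.val he
    rw [← Ordinal.toZFSet_zero] at this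
    exact Ordinal.omega0_ne_zero (Ordinal.toZFSet_injective this).symm
  have hone : j one = one := h.fix _ (h.omega_mem hT)
  have hβL : β.1 ⊆ L.1 := fun x hx => hκL (h.isOrdinal.mem_trans hx hβ)
  obtain ⟨f, hf⟩ := hL.exists_app₂ (fun ξ ν =>
    if ∃ (hξ : ξ.1 ∈ κ.1) (hν : ν.1 ∈ β.1), ⟨ν, hν⟩ ∈ G ⟨ξ, hξ⟩ then one else zero)
  have hf' : ∀ ξ ν : ↥M, ∀ (hξ : ξ.1 ∈ κ.1) (hν : ν.1 ∈ β.1),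
      App₂ f ξ ν one ↔ ⟨ν, hν⟩ ∈ G ⟨ξ, hξ⟩ := by
    intro ξ ν hξ hν
    rw [hf]
    by_cases hG : ⟨ν, hν⟩ ∈ G ⟨ξ, hξ⟩
    · simp [hG, hξ, hν, hκL hξ, hβL hν]
    · simp [hG, h01.symm]
  have inj : ∀ ξ ξ' : ↥M, ξ.1 ∈ κ.1 → ξ'.1 ∈ κ.1 →
      (∀ ν : ↥M, ν.1 ∈ β.1 → (App₂ f ξ ν one ↔ App₂ f ξ' ν one)) → ξ = ξ' := by
    intro ξ ξ' hξ hξ' heq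
    have : G ⟨ξ, hξ⟩ = G ⟨ξ', hξ'⟩ := by
      ext ⟨ν, hν⟩
      rw [← hf', ← hf']
      exact heq ν hν
    simpa using G.injective this
  have inj' := (transfer₄ j (fun κ β f one => ∀ ξ ξ' : ↥M, ξ.1 ∈ κ.1 → ξ'.1 ∈ κ.1 →
      (∀ ν : ↥M, ν.1 ∈ β.1 → (App₂ f ξ ν one ↔ App₂ f ξ' ν one)) → ξ = ξ') κ β f one).2 inj
  obtain ⟨y, hy⟩ := hL (fun ν => if App₂ (j f) κ ν one then one else zero)
  have hy' : ∀ ν : ↥M, ν.1 ∈ β.1 → (App y ν one ↔ App₂ (j f) κ ν one) := by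
    intro ν hν
    rw [hy]
    by_cases hG : App₂ (j f) κ ν one
    · simp [hG, hβL hν]
    · simp [hG, h01.symm]
  have hfixν : ∀ ν : ↥M, ν.1 ∈ β.1 → j ν = ν := fun ν hν =>
    h.fix ν (h.isOrdinal.mem_trans hν hβ)
  have ex' : ∃ ξ : ↥M, ξ.1 ∈ (j κ).1 ∧ ∀ ν : ↥M, ν.1 ∈ (j β).1 →
      (App₂ (j f) ξ ν (j one) ↔ App (j y) ν (j one)) := by
    refine ⟨κ, h.mem_map, fun ν hν => ?_⟩
    rw [h.fix β hβ] at hν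
    have := app_map_iff j y ν one
    rw [hfixν ν hν] at this
    rw [this, hy' ν hν, hone]
  obtain ⟨ξ, hξ, hξy⟩ := (transfer₅ j (fun κ β f y one => ∃ ξ : ↥M, ξ.1 ∈ κ.1 ∧
    ∀ ν : ↥M, ν.1 ∈ β.1 → (App₂ f ξ ν one ↔ App y ν one)) κ β f y one).1 ex'
  have hκξ : κ = ξ := by
    refine inj' κ ξ h.mem_map ?_ fun ν hν => ?_
    · have := (map_mem_iff j ξ κ).2 hξ
      rwa [h.fix ξ hξ] at this
    · rw [h.fix β hβ] at hν
      have := app₂_map_iff j f ξ ν one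
      rw [h.fix ξ hξ, hfixν ν hν] at this
      rw [this, hξy ν hν, hy' ν hν, hone]
  rw [hκξ] at hξ
  exact ZFSet.mem_irrefl _ hξ

end Crit

section Cover

variable {M : Set ZFSet.{u}}

theorem RegularCard.exists_bound {lam : ZFSet} (h : RegularCard lam) {β : ZFSet} (hβ : β ∈ lam)
    (G : ZFSet → ZFSet) (hG : ∀ ξ ∈ β, G ξ ∈ lam) : ∃ ζ ∈ lam, ∀ ξ ∈ β, G ξ ∈ ζ := by
  obtain ⟨ho, -, -, hr⟩ := h
  let f := ZFSet.pairSep (fun a b => b = G a) β lam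
  have hf : ∀ a b, a.pair b ∈ f ↔ a ∈ β ∧ b = G a := by
    intro a b
    simp only [f, ZFSet.mem_pairSep, ZFSet.pair_inj]
    constructor
    · rintro ⟨a', ha, b', hb, ⟨rfl, rfl⟩, hG⟩
      exact ⟨ha, hG⟩
    · rintro ⟨ha, rfl⟩
      exact ⟨a, ha, _, hG a ha, ⟨rfl, rfl⟩, rfl⟩
  have hfunc : ZFSet.IsFunc β lam f := by
    refine ⟨fun p hp => ?_, fun z hz => ⟨G z, (hf _ _).2 ⟨hz, rfl⟩, fun y hy => ((hf _ _).1 hy).2⟩⟩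
    obtain ⟨a, ha, b, hb, rfl, -⟩ := ZFSet.mem_pairSep.1 hp
    exact ZFSet.pair_mem_prod.2 ⟨ha, hb⟩
  have := hr β hβ f hfunc
  simp only [CofinalIn, not_forall] at this
  obtain ⟨γ, hγ, hno⟩ := this
  refine ⟨γ, hγ, fun ξ hξ => ?_⟩
  rcases (ho.mem hγ).mem_trichotomous (ho.mem (hG ξ hξ)) with h | h | h
  · exact absurd ⟨ξ, hξ, _, (hf _ _).2 ⟨hξ, rfl⟩, Or.inl h⟩ hno
  · exact absurd ⟨ξ, hξ, _, (hf _ _).2 ⟨hξ, rfl⟩, Or.inr h⟩ hno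
  · exact h

theorem RegularCard.exists_bound_subtype (hT : SetTransitive M) {L : ↥M} (h : RegularCard L.1)
    {β : ↥M} (hβ : β.1 ∈ L.1) (G : ↥M → ↥M) (hG : ∀ ξ : ↥M, ξ.1 ∈ β.1 → (G ξ).1 ∈ L.1) :
    ∃ ζ : ↥M, ζ.1 ∈ L.1 ∧ ∀ ξ : ↥M, ξ.1 ∈ β.1 → (G ξ).1 ∈ ζ.1 := by
  classical
  obtain ⟨ζ, hζ, hb⟩ := h.exists_bound hβ (fun x => if hx : x ∈ M then (G ⟨x, hx⟩).1 else ∅)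
    (fun ξ hξ => by
      have hM := hT _ β.2 _ hξ
      simpa [hM] using hG ⟨ξ, hM⟩ hξ)
  exact ⟨⟨ζ, hT _ L.2 _ hζ⟩, hζ, fun ξ hξ => by simpa using hb ξ.1 hξ⟩

/-- If every function from an element of the ordinal `L` to `L` is bounded, one can iterate
a function `nx : L → L` along `L`. -/
theorem exists_iterate {L : ↥M} (hL : L.1.IsOrdinal)
    (hbd : ∀ β : ↥M, β.1 ∈ L.1 → ∀ G : ↥M → ↥M, (∀ ξ : ↥M, ξ.1 ∈ β.1 → (G ξ).1 ∈ L.1) →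
      ∃ ζ : ↥M, ζ.1 ∈ L.1 ∧ ∀ ξ : ↥M, ξ.1 ∈ β.1 → (G ξ).1 ∈ ζ.1)
    (nx : ↥M → ↥M) (hnx : ∀ ν : ↥M, ν.1 ∈ L.1 → (nx ν).1 ∈ L.1) :
    ∃ η : ↥M → ↥M, ∀ ξ : ↥M, ξ.1 ∈ L.1 →
      (η ξ).1 ∈ L.1 ∧ ∀ ζ : ↥M, ζ.1 ∈ ξ.1 → (nx (η ζ)).1 ∈ (η ξ).1 := by
  classical
  have wf : WellFounded (fun x y : ↥M => x.1 ∈ y.1) := InvImage.wf Subtype.val ZFSet.mem_wf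
  let step : ∀ x : ↥M, (∀ y : ↥M, y.1 ∈ x.1 → ↥M) → ↥M := fun x ih =>
    if h : ∃ b : ↥M, b.1 ∈ L.1 ∧ ∀ (y : ↥M) (hy : y.1 ∈ x.1), (nx (ih y hy)).1 ∈ b.1 then h.choose
    else x
  refine ⟨wf.fix step, fun ξ => ?_⟩
  induction ξ using wf.induction with
  | _ ξ ih =>
    intro hξ
    have hex : ∃ b : ↥M, b.1 ∈ L.1 ∧
        ∀ (y : ↥M) (_ : y.1 ∈ ξ.1), (nx (wf.fix step y)).1 ∈ b.1 :=
      hbd ξ hξ (fun y => nx (wf.fix step y)) fun y hy =>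
        hnx _ (ih y hy (hL.mem_trans hy hξ)).1
    have heq : wf.fix step ξ = hex.choose := by
      rw [wf.fix_eq]
      exact dif_pos hex
    rw [heq]
    exact hex.choose_spec

/-- The restriction of `c` to `β` is a single-valued relation cofinal in `α`. -/
def CofSeq (α β c : ↥M) : Prop :=
  ∀ η : ↥M, η.1 ∈ α.1 → ∃ ξ : ↥M, ξ.1 ∈ β.1 ∧ ∃ θ : ↥M, θ.1 ∈ α.1 ∧ App c ξ θ ∧
    (η.1 ∈ θ.1 ∨ η = θ)

instance Dfn.cofSeq {n : ℕ} (i k l : Fin n) :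
    Dfn (M := M) fun v => CofSeq (v i) (v k) (v l) := by
  unfold CofSeq
  infer_instance

/-- The restriction of `c` to `β` is single-valued. -/
def SingleValued (β c : ↥M) : Prop :=
  ∀ ξ : ↥M, ξ.1 ∈ β.1 → ∀ θ θ' : ↥M, App c ξ θ → App c ξ θ' → θ = θ'

instance Dfn.singleValued {n : ℕ} (i k : Fin n) :
    Dfn (M := M) fun v => SingleValued (v i) (v k) := by
  unfold SingleValued
  infer_instance

/-- `L` is regular inside `M`. -/
def RegIn (L : ↥M) : Prop :=
  ∀ β f : ↥M, β.1 ∈ L.1 → SingleValued β f →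
    (∀ ξ : ↥M, ξ.1 ∈ β.1 → ∃ η : ↥M, η.1 ∈ L.1 ∧ App f ξ η) →
    ∃ ζ : ↥M, ζ.1 ∈ L.1 ∧ ∀ ξ η : ↥M, ξ.1 ∈ β.1 → App f ξ η → η.1 ∈ ζ.1

instance Dfn.regIn {n : ℕ} (i : Fin n) : Dfn (M := M) fun v => RegIn (v i) := by
  unfold RegIn
  infer_instance

theorem RegularCard.regIn (hT : SetTransitive M) {L : ↥M} (h : RegularCard L.1) : RegIn L := by
  intro β f hβ hs hf
  choose! G hG hGf using hf
  obtain ⟨ζ, hζ, hb⟩ := h.exists_bound_subtype hT hβ G hG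
  exact ⟨ζ, hζ, fun ξ η hξ hη => by
    rw [hs ξ hξ _ _ hη (hGf ξ hξ)]
    exact hb ξ hξ⟩

open Cardinal in
theorem Moves.exists_cover (hT : SetTransitive M) {j : ↥M ↪ₑ[ZFLang] ↥M} {κ L : ↥M}
    (h : Moves j κ) (hL : SeqClosed L) (hreg : RegularCard L.1) (hκL : κ.1 ∈ L.1 ∨ κ = L)
    (hLj : L.1 ∈ (j κ).1) :
    ∃ (b : ↥M → ↥M) (N : ↥M → Set ↥M),
      (∀ α, (b α).1 ∈ κ.1 ∧ #(N α) ≤ Cardinal.lift.{u + 1} (b α).1.card) ∧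
      ∀ δ : ↥M, δ.1 ∈ κ.1 → ∀ E : ↥M → ↥M, (∀ i : ↥M, i.1 ∈ δ.1 → (E i).1 ∈ L.1) →
        ∃ α : ↥M, α.1 ∈ L.1 ∧ ∀ i : ↥M, i.1 ∈ δ.1 → E i ∈ N α := by
  have hLo : L.1.IsOrdinal := hreg.1
  have hjL : (j L).1.IsOrdinal := isOrdinal_map hT j hLo
  have hκsub : κ.1 ⊆ L.1 := by
    rcases hκL with h | rfl
    · exact hLo.subset_of_mem h
    · exact subset_rfl
  have hLjL : L.1 ∈ (j L).1 := by
    rcases hκL with h | rfl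
    · exact hjL.mem_trans hLj ((map_mem_iff j _ _).2 h)
    · exact hLj
  let zero : ↥M := ⟨∅, hT _ κ.2 _ (h.empty_mem hT)⟩
  have hzero : ∀ z : ZFSet, z ∉ zero.1 := ZFSet.notMem_empty
  have hlim : ∀ α : ↥M, α.1 ∈ L.1 → ∃ ζ : ↥M, ζ.1 ∈ L.1 ∧ α.1 ∈ ζ.1 := by
    intro α hα
    obtain ⟨ζ, hζ, hb⟩ := hreg.exists_bound_subtype hT
      (β := ⟨_, hT _ κ.2 _ (h.omega_mem hT)⟩) (hκsub (h.omega_mem hT)) (fun _ => α)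
      (fun _ _ => hα)
    exact ⟨ζ, hζ, hb zero empty_mem_omega⟩
  obtain ⟨g, hg⟩ := hL j
  have hgs : SingleValued L g := fun ξ _ θ θ' h₁ h₂ =>
    ((hg _ _).1 h₁).2.trans ((hg _ _).1 h₂).2.symm
  -- the supremum of the pointwise image of `L`
  obtain ⟨γ, hγL, hγ, hγmin⟩ : ∃ γ : ↥M, γ.1 ∈ (j L).1 ∧
      (∀ α : ↥M, α.1 ∈ L.1 → (j α).1 ∈ γ.1) ∧
      ∀ θ : ↥M, θ.1 ∈ γ.1 → ∃ α : ↥M, α.1 ∈ L.1 ∧ θ.1 ∈ (j α).1 := by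
    have hR := (transfer₁ j RegIn L).2 (hreg.regIn hT)
    obtain ⟨ζ, hζ, hb⟩ := hR L g hLjL hgs fun ξ hξ =>
      ⟨j ξ, (map_mem_iff j _ _).2 hξ, (hg _ _).2 ⟨hξ, rfl⟩⟩
    obtain ⟨γ, ⟨hγ₁, hγ₂⟩, hmin⟩ := ZFSet.mem_wf.has_min
      {z : ZFSet | z ∈ (j L).1 ∧ ∀ α : ↥M, α.1 ∈ L.1 → (j α).1 ∈ z}
      ⟨ζ.1, hζ, fun α hα => hb α _ hα ((hg _ _).2 ⟨hα, rfl⟩)⟩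
    refine ⟨⟨γ, hT _ (j L).2 _ hγ₁⟩, hγ₁, hγ₂, fun θ hθ => ?_⟩
    have hθL := hjL.mem_trans hθ hγ₁
    by_contra! hno
    refine hmin θ.1 ⟨hθL, fun α hα => ?_⟩ hθ
    obtain ⟨ζ, hζ, hαζ⟩ := hlim α hα
    exact ((hjL.mem hθL).notMem_iff_subset (hjL.mem ((map_mem_iff j _ _).2 hζ))).1 (hno ζ hζ)
      ((map_mem_iff j _ _).2 hαζ)
  -- short cofinal sequences
  have hchoose : ∀ α : ↥M, ∃ p : ↥M × ↥M, p.1.1 ∈ κ.1 ∧ SingleValued p.1 p.2 ∧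
      ((∃ β c : ↥M, β.1 ∈ κ.1 ∧ SingleValued β c ∧ CofSeq α β c) → CofSeq α p.1 p.2) := by
    intro α
    by_cases hex : ∃ β c : ↥M, β.1 ∈ κ.1 ∧ SingleValued β c ∧ CofSeq α β c
    · obtain ⟨β, c, h₁, h₂, h₃⟩ := hex
      exact ⟨(β, c), h₁, h₂, fun _ => h₃⟩
    · exact ⟨(zero, zero), h.empty_mem hT, fun ξ hξ => (hzero _ hξ).elim, fun h => (hex h).elim⟩
  choose p hpκ hps hpc using hchoose
  obtain ⟨B, hB⟩ := hL fun α => (p α).1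
  obtain ⟨C, hC⟩ := hL fun α => (p α).2
  obtain ⟨β', c', hβ', hc', hcof⟩ : ∃ β c : ↥M, App (j B) γ β ∧ App (j C) γ c ∧
      CofSeq γ β c := by
    have key : ∀ α : ↥M, α.1 ∈ L.1 →
        (∃ β c : ↥M, β.1 ∈ κ.1 ∧ SingleValued β c ∧ CofSeq α β c) →
        ∃ β c : ↥M, App B α β ∧ App C α c ∧ CofSeq α β c :=
      fun α hα hex => ⟨_, _, (hB _ _).2 ⟨hα, rfl⟩, (hC _ _).2 ⟨hα, rfl⟩, hpc α hex⟩
    refine (transfer₄ j (fun κ L B C => ∀ α : ↥M, α.1 ∈ L.1 →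
        (∃ β c : ↥M, β.1 ∈ κ.1 ∧ SingleValued β c ∧ CofSeq α β c) →
        ∃ β c : ↥M, App B α β ∧ App C α c ∧ CofSeq α β c) κ L B C).2 key γ hγL
      ⟨L, g, hLj, hgs, fun η hη => ?_⟩
    obtain ⟨α, hα, hηα⟩ := hγmin η hη
    exact ⟨α, hα, j α, hγ α hα, (hg _ _).2 ⟨hα, rfl⟩, Or.inl hηα⟩
  -- consecutive blocks of `L`, each of which is met by the cofinal sequence after applying `j`
  have hnext : ∀ ν : ↥M, ∃ ν' : ↥M, ν.1 ∈ L.1 → ν'.1 ∈ L.1 ∧ ∃ ξ θ : ↥M, ξ.1 ∈ β'.1 ∧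
      App c' ξ θ ∧ ((j ν).1 ∈ θ.1 ∨ j ν = θ) ∧ θ.1 ∈ (j ν').1 := by
    intro ν
    by_cases hν : ν.1 ∈ L.1
    · obtain ⟨ξ, hξ, θ, hθ, hcθ, hle⟩ := hcof (j ν) (hγ ν hν)
      obtain ⟨ν', hν', hlt⟩ := hγmin θ hθ
      exact ⟨ν', fun _ => ⟨hν', ξ, θ, hξ, hcθ, hle, hlt⟩⟩
    · exact ⟨ν, fun h => (hν h).elim⟩
  choose nx hnx using hnext
  obtain ⟨η, hη⟩ := exists_iterate hLo (fun β hβ G hG => hreg.exists_bound_subtype hT hβ G hG) nx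
    fun ν hν => (hnx ν hν).1
  obtain ⟨Lo, hLo'⟩ := hL η
  obtain ⟨Up, hUp⟩ := hL fun ξ => nx (η ξ)
  refine ⟨fun α => (p α).1, fun α => {ξ | ξ.1 ∈ L.1 ∧ ∃ ν θ : ↥M, ν.1 ∈ (p α).1.1 ∧
    App (p α).2 ν θ ∧ ((η ξ).1 ∈ θ.1 ∨ η ξ = θ) ∧ θ.1 ∈ (nx (η ξ)).1},
    fun α => ⟨hpκ α, ?_⟩, fun δ hδ E hE => ?_⟩
  · rw [← mk_subtype_mem hT]
    have hdisj : ∀ ζ ξ θ : ↥M, ξ.1 ∈ L.1 → ζ.1 ∈ ξ.1 → θ.1 ∈ (nx (η ζ)).1 →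
        ((η ξ).1 ∈ θ.1 ∨ η ξ = θ) → False := by
      intro ζ ξ θ hξ hζ hθ hle
      have hθ' := (hLo.mem (hη ξ hξ).1).mem_trans hθ ((hη ξ hξ).2 ζ hζ)
      rcases hle with hle | rfl
      · exact ZFSet.mem_asymm hle hθ'
      · exact ZFSet.mem_irrefl _ hθ'
    choose! ν θ hν₁ hν₂ hν₃ hν₄ using fun (ξ : ↥M) (hξ : ∃ ν θ : ↥M, ν.1 ∈ (p α).1.1 ∧
      App (p α).2 ν θ ∧ ((η ξ).1 ∈ θ.1 ∨ η ξ = θ) ∧ θ.1 ∈ (nx (η ξ)).1) => hξ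
    refine Cardinal.mk_le_of_injective
      (f := fun ξ => (⟨ν ξ, hν₁ ξ ξ.2.2⟩ : {x : ↥M // x.1 ∈ (p α).1.1})) ?_
    rintro ⟨ξ, hξ⟩ ⟨ζ, hζ⟩ he
    have he' : ν ξ = ν ζ := congrArg Subtype.val he
    have h₂ := hν₂ ξ hξ.2
    have h₃ := hν₃ ξ hξ.2
    have h₄ := hν₄ ξ hξ.2
    have k₃ := hν₃ ζ hζ.2
    have k₄ := hν₄ ζ hζ.2
    rw [he'] at h₂
    have hθ := hps α _ (hν₁ ζ hζ.2) _ _ h₂ (hν₂ ζ hζ.2)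
    rw [hθ] at h₃ h₄
    rcases (hLo.mem hξ.1).mem_trichotomous (hLo.mem hζ.1) with hlt | heq | hlt
    · exact (hdisj _ _ _ hζ.1 hlt h₄ k₃).elim
    · exact Subtype.ext (Subtype.ext heq)
    · exact (hdisj _ _ _ hξ.1 hlt k₄ h₃).elim
  · have hδL : ∀ i : ↥M, i.1 ∈ δ.1 → i.1 ∈ L.1 := fun i hi =>
      hκsub (h.isOrdinal.mem_trans hi hδ)
    obtain ⟨e, he⟩ := hL E
    have up : ∃ α β c : ↥M, α.1 ∈ (j L).1 ∧ App (j B) α β ∧ App (j C) α c ∧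
        ∀ i : ↥M, i.1 ∈ (j δ).1 → ∃ ξ l u : ↥M, App (j e) i ξ ∧ App (j Lo) ξ l ∧ App (j Up) ξ u ∧
          ∃ ν θ : ↥M, ν.1 ∈ β.1 ∧ App c ν θ ∧ (l.1 ∈ θ.1 ∨ l = θ) ∧ θ.1 ∈ u.1 := by
      refine ⟨γ, β', c', hγL, hβ', hc', fun i hi => ?_⟩
      rw [h.fix δ hδ] at hi
      have hEi := hE i hi
      refine ⟨j (E i), j (η (E i)), j (nx (η (E i))), ?_, (app_map_iff j _ _ _).2
        ((hLo' _ _).2 ⟨hEi, rfl⟩), (app_map_iff j _ _ _).2 ((hUp _ _).2 ⟨hEi, rfl⟩),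
        (hnx _ (hη _ hEi).1).2⟩
      rw [← h.fix i (h.isOrdinal.mem_trans hi hδ), app_map_iff, h.fix i
        (h.isOrdinal.mem_trans hi hδ)]
      exact (he _ _).2 ⟨hδL i hi, rfl⟩
    obtain ⟨α, β, c, hα, hBα, hCα, hcov⟩ := (transfer₇ j (fun L B C δ e Lo Up =>
      ∃ α β c : ↥M, α.1 ∈ L.1 ∧ App B α β ∧ App C α c ∧
        ∀ i : ↥M, i.1 ∈ δ.1 → ∃ ξ l u : ↥M, App e i ξ ∧ App Lo ξ l ∧ App Up ξ u ∧
          ∃ ν θ : ↥M, ν.1 ∈ β.1 ∧ App c ν θ ∧ (l.1 ∈ θ.1 ∨ l = θ) ∧ θ.1 ∈ u.1)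
      L B C δ e Lo Up).1 up
    obtain ⟨-, rfl⟩ := (hB _ _).1 hBα
    obtain ⟨-, rfl⟩ := (hC _ _).1 hCα
    refine ⟨α, hα, fun i hi => ?_⟩
    obtain ⟨ξ, l, u, h₁, h₂, h₃, h₄⟩ := hcov i hi
    obtain ⟨-, rfl⟩ := (he _ _).1 h₁
    obtain ⟨-, rfl⟩ := (hLo' _ _).1 h₂
    obtain ⟨-, rfl⟩ := (hUp _ _).1 h₃
    exact ⟨hE i hi, h₄⟩

end Cover

section Functions

theorem exists_graph {a b : ZFSet.{u}} (F : {x // x ∈ a} → {x // x ∈ b}) :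
    ∃ f, ZFSet.IsFunc a b f ∧ ∀ x y, x.pair y ∈ f ↔ ∃ h : x ∈ a, y = (F ⟨x, h⟩).1 := by
  have hf : ∀ x y, x.pair y ∈ ZFSet.pairSep (fun x y => ∃ h : x ∈ a, y = (F ⟨x, h⟩).1) a b ↔
      ∃ h : x ∈ a, y = (F ⟨x, h⟩).1 := by
    intro x y
    simp only [ZFSet.mem_pairSep, ZFSet.pair_inj]
    constructor
    · rintro ⟨x, -, y, -, ⟨rfl, rfl⟩, h⟩
      exact h
    · rintro ⟨h, rfl⟩
      exact ⟨x, h, _, (F ⟨x, h⟩).2, ⟨rfl, rfl⟩, h, rfl⟩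
  refine ⟨_, ⟨fun p hp => ?_, fun z hz => ⟨_, (hf _ _).2 ⟨hz, rfl⟩, fun y hy => ?_⟩⟩, hf⟩
  · obtain ⟨x, hx, y, hy, rfl, -⟩ := ZFSet.mem_pairSep.1 hp
    exact ZFSet.pair_mem_prod.2 ⟨hx, hy⟩
  · exact ((hf _ _).1 hy).2

theorem exists_injZFunc {a b : ZFSet.{u}} (h : a.card ≤ b.card) : ∃ f, InjZFunc a b f := by
  rw [← Cardinal.lift_le.{u + 1}, ← ZFSet.cardinalMk_coe_sort, ← ZFSet.cardinalMk_coe_sort,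
    Cardinal.le_def] at h
  obtain ⟨F⟩ := h
  obtain ⟨f, hf, hF⟩ := exists_graph fun x => F x
  refine ⟨f, hf, fun x y z hx hy => ?_⟩
  obtain ⟨hx, rfl⟩ := (hF _ _).1 hx
  obtain ⟨hy, he⟩ := (hF _ _).1 hy
  exact congrArg Subtype.val (F.injective (Subtype.ext he))

theorem equinumerous_of_card_eq {a b : ZFSet.{u}} (h : a.card = b.card) : Equinumerous a b := by
  rw [← Cardinal.lift_inj.{u, u + 1}, ← ZFSet.cardinalMk_coe_sort, ← ZFSet.cardinalMk_coe_sort,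
    Cardinal.eq] at h
  obtain ⟨F⟩ := h
  obtain ⟨f, hf, hF⟩ := exists_graph fun x => F x
  refine ⟨f, hf, fun x y z hx hy => ?_, fun w hw => ⟨(F.symm ⟨w, hw⟩).1, ?_⟩⟩
  · obtain ⟨hx, rfl⟩ := (hF _ _).1 hx
    obtain ⟨hy, he⟩ := (hF _ _).1 hy
    exact congrArg Subtype.val (F.injective (Subtype.ext he))
  · exact (hF _ _).2 ⟨(F.symm ⟨w, hw⟩).2, by simp⟩

end Functions

section Successor

variable {M : Set ZFSet.{u}}

/-- The combinatorial properties of the cardinal successor `μ` of an infinite ordinal `σ`. -/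
structure SuccOf (σ μ : ↥M) : Prop where
  isOrdinal : μ.1.IsOrdinal
  subset : σ.1 ⊆ μ.1
  limit : ∀ α : ↥M, α.1 ∈ μ.1 → ∃ ζ : ↥M, ζ.1 ∈ μ.1 ∧ α.1 ∈ ζ.1
  inj : ∀ β : ↥M, β.1 ∈ μ.1 → ∃ e : ↥M → ↥M, (∀ α : ↥M, α.1 ∈ β.1 → (e α).1 ∈ σ.1) ∧
    ∀ α α' : ↥M, α.1 ∈ β.1 → α'.1 ∈ β.1 → e α = e α' → α = α'
  not_inj : ∀ p q : ↥M → ↥M, (∀ α : ↥M, α.1 ∈ μ.1 → (p α).1 ∈ σ.1 ∧ (q α).1 ∈ σ.1) →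
    ∃ α α' : ↥M, α.1 ∈ μ.1 ∧ α'.1 ∈ μ.1 ∧ p α = p α' ∧ q α = q α' ∧ α ≠ α'

open Cardinal in
theorem exists_inj_of_card_le (hT : SetTransitive M) {β σ : ↥M} (h : β.1.card ≤ σ.1.card) :
    ∃ e : ↥M → ↥M, (∀ α : ↥M, α.1 ∈ β.1 → (e α).1 ∈ σ.1) ∧
      ∀ α α' : ↥M, α.1 ∈ β.1 → α'.1 ∈ β.1 → e α = e α' → α = α' := by
  classical
  rw [← Cardinal.lift_le.{u + 1}, ← mk_subtype_mem hT, ← mk_subtype_mem hT, Cardinal.le_def] at h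
  obtain ⟨F⟩ := h
  refine ⟨fun α => if h : α.1 ∈ β.1 then (F ⟨α, h⟩).1 else α, fun α hα => ?_,
    fun α α' hα hα' he => ?_⟩
  · simpa [hα] using (F ⟨α, hα⟩).2
  · simp only [hα, hα', dif_pos] at he
    exact congrArg Subtype.val (F.injective (Subtype.ext he))

open Cardinal in
theorem exists_succOf (hT : SetTransitive M) (hO : ∀ x : ZFSet.{u}, x.IsOrdinal → x ∈ M)
    {σ L : ↥M} (hreg : RegularCard L.1) (hσ : σ.1 ∈ L.1)
    (hω : Ordinal.omega0.toZFSet ⊆ σ.1) : ∃ μ : ↥M, SuccOf σ μ ∧ μ.1 ⊆ L.1 := by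
  have hσo : σ.1.IsOrdinal := hreg.1.mem hσ
  have hinf : ℵ₀ ≤ σ.1.card := by
    have := ZFSet.card_mono hω
    rwa [Ordinal.card_toZFSet, Ordinal.card_omega0] at this
  set o : Ordinal.{u} := (Order.succ σ.1.card).ord with ho
  have hσc : σ.1.card = σ.1.rank.card := by
    rw [← Ordinal.card_toZFSet, hσo.toZFSet_rank_eq]
  have hlt : ∀ a < o, a.card ≤ σ.1.card := fun a ha =>
    Order.lt_succ_iff.1 (Cardinal.lt_ord.1 ha)
  refine ⟨⟨o.toZFSet, hO _ (ZFSet.isOrdinal_toZFSet o)⟩, ⟨ZFSet.isOrdinal_toZFSet o, ?_, ?_, ?_, ?_⟩,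
    ?_⟩
  · have : σ.1.rank ≤ o := by
      rw [← not_lt, ho]
      intro h
      have := Ordinal.card_le_card h.le
      rw [Cardinal.card_ord, ← hσc, Order.succ_le_iff] at this
      exact lt_irrefl _ this
    rwa [← Ordinal.toZFSet_subset_toZFSet_iff, hσo.toZFSet_rank_eq] at this
  · rintro ⟨α, hαM⟩ hα
    obtain ⟨a, ha, rfl⟩ := Ordinal.mem_toZFSet_iff.1 hα
    refine ⟨⟨(Order.succ a).toZFSet, hO _ (ZFSet.isOrdinal_toZFSet _)⟩, ?_, ?_⟩
    · exact Ordinal.toZFSet_mem_toZFSet_iff.2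
        ((Cardinal.isSuccLimit_ord (hinf.trans (Order.le_succ _))).succ_lt ha)
    · exact Ordinal.toZFSet_mem_toZFSet_iff.2 (Order.lt_succ a)
  · rintro ⟨β, hβM⟩ hβ
    refine exists_inj_of_card_le hT ?_
    obtain ⟨a, ha, rfl⟩ := Ordinal.mem_toZFSet_iff.1 hβ
    rw [Ordinal.card_toZFSet]
    exact hlt a ha
  · intro p q hpq
    by_contra! hno
    have hle : #{x : ↥M // x.1 ∈ o.toZFSet} ≤
        #({x : ↥M // x.1 ∈ σ.1} × {x : ↥M // x.1 ∈ σ.1}) := by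
      refine Cardinal.mk_le_of_injective
        (f := fun x => (⟨p x, (hpq x x.2).1⟩, ⟨q x, (hpq x x.2).2⟩)) ?_
      rintro ⟨x, hx⟩ ⟨y, hy⟩ he
      simp only [Prod.mk.injEq, Subtype.mk.injEq] at he
      exact Subtype.ext (hno x y hx hy he.1 he.2)
    rw [mk_prod, Cardinal.lift_id, mk_subtype_mem hT σ,
      mk_subtype_mem hT ⟨o.toZFSet, hO _ (ZFSet.isOrdinal_toZFSet o)⟩, ← Cardinal.lift_mul,
      Cardinal.lift_le, Cardinal.mul_eq_self hinf, Ordinal.card_toZFSet, ho, Cardinal.card_ord,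
      Order.succ_le_iff] at hle
    exact lt_irrefl _ hle
  · change o.toZFSet ⊆ L.1
    by_contra hsub
    rw [ZFSet.IsOrdinal.not_subset_iff_mem (ZFSet.isOrdinal_toZFSet o) hreg.1,
      Ordinal.mem_toZFSet_iff] at hsub
    obtain ⟨a, ha, hL⟩ := hsub
    refine hreg.2.2.1 σ.1 hσ (exists_injZFunc ?_)
    rw [← hL, Ordinal.card_toZFSet]
    exact hlt a ha

variable {σ μ : ↥M}

theorem SuccOf.exists_bound (h : SuccOf σ μ) (G : ↥M → ↥M)
    (hG : ∀ ξ : ↥M, ξ.1 ∈ σ.1 → (G ξ).1 ∈ μ.1) :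
    ∃ ζ : ↥M, ζ.1 ∈ μ.1 ∧ ∀ ξ : ↥M, ξ.1 ∈ σ.1 → (G ξ).1 ∈ ζ.1 := by
  obtain ⟨ζ, hζ, hb⟩ : ∃ ζ : ↥M, ζ.1 ∈ μ.1 ∧ ∀ ξ : ↥M, ξ.1 ∈ σ.1 → (G ξ).1 ⊆ ζ.1 := by
    by_contra! hno
    have hno' : ∀ ζ : ↥M, ζ.1 ∈ μ.1 → ∃ ξ : ↥M, ξ.1 ∈ σ.1 ∧ ζ.1 ∈ (G ξ).1 := fun ζ hζ => by
      obtain ⟨ξ, hξ, hn⟩ := hno ζ hζ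
      exact ⟨ξ, hξ, ((h.isOrdinal.mem (hG ξ hξ)).not_subset_iff_mem (h.isOrdinal.mem hζ)).1 hn⟩
    choose! p hp hpG using hno'
    choose! e he hinj using h.inj
    obtain ⟨α, α', hα, hα', h₁, h₂, hne⟩ := h.not_inj p (fun α => e (G (p α)) α) fun α hα =>
      ⟨hp α hα, he _ (hG _ (hp α hα)) _ (hpG α hα)⟩
    refine hne (hinj _ (hG _ (hp α hα)) _ _ (hpG α hα) ?_ ?_)
    · rw [h₁]
      exact hpG α' hα'
    · rw [h₂, h₁]
  obtain ⟨ζ', hζ', hlt⟩ := h.limit ζ hζ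
  exact ⟨ζ', hζ', fun ξ hξ => (h.isOrdinal.mem (hG ξ hξ)).mem_of_subset_of_mem
    (h.isOrdinal.mem hζ') (hb ξ hξ) hlt⟩

theorem SuccOf.exists_bound_of_mem (h : SuccOf σ μ) {β : ↥M}
    (hβ : β.1 ∈ μ.1) (G : ↥M → ↥M) (hG : ∀ ξ : ↥M, ξ.1 ∈ β.1 → (G ξ).1 ∈ μ.1) :
    ∃ ζ : ↥M, ζ.1 ∈ μ.1 ∧ ∀ ξ : ↥M, ξ.1 ∈ β.1 → (G ξ).1 ∈ ζ.1 := by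
  classical
  obtain ⟨e, he, hinj⟩ := h.inj β hβ
  obtain ⟨ζ, hζ, hb⟩ := h.exists_bound
    (fun ν => if hν : ∃ ξ : ↥M, ξ.1 ∈ β.1 ∧ e ξ = ν then G hν.choose else β) fun ν _ => by
      split_ifs with hν
      · exact hG _ hν.choose_spec.1
      · exact hβ
  refine ⟨ζ, hζ, fun ξ hξ => ?_⟩
  have hex : ∃ ξ' : ↥M, ξ'.1 ∈ β.1 ∧ e ξ' = e ξ := ⟨ξ, hξ, rfl⟩
  have := hb (e ξ) (he ξ hξ)
  rw [dif_pos hex, hinj _ _ hex.choose_spec.1 hξ hex.choose_spec.2] at this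
  exact this

/-- A bounded family of elements of an ordinal has a least strict upper bound. -/
theorem exists_strict_sup (hT : SetTransitive M) {ι : Sort*} (hμ : μ.1.IsOrdinal) (B : ι → ↥M)
    (hB : ∃ ζ : ↥M, ζ.1 ∈ μ.1 ∧ ∀ i, (B i).1 ∈ ζ.1) :
    ∃ γ : ↥M, γ.1 ∈ μ.1 ∧ (∀ i, (B i).1 ∈ γ.1) ∧
      ∀ θ : ↥M, θ.1 ∈ γ.1 → ∃ i, θ.1 ⊆ (B i).1 := by
  obtain ⟨ζ, hζ, hb⟩ := hB
  obtain ⟨γ, ⟨hγ₁, hγ₂⟩, hmin⟩ := ZFSet.mem_wf.has_min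
    {z : ZFSet | z ∈ μ.1 ∧ ∀ i, (B i).1 ∈ z} ⟨ζ.1, hζ, hb⟩
  refine ⟨⟨γ, hT _ μ.2 _ hγ₁⟩, hγ₁, hγ₂, fun θ hθ => ?_⟩
  have hθμ := hμ.mem_trans hθ hγ₁
  by_contra! hno
  refine hmin θ.1 ⟨hθμ, fun i => ?_⟩ hθ
  exact ((hμ.mem hθμ).not_subset_iff_mem (hμ.mem (hμ.mem_trans (hγ₂ i) hγ₁))).1 (hno i)

end Successor

section Stationary

variable {M : Set ZFSet.{u}}

theorem exists_index (hT : SetTransitive M) {ω : ↥M} (hω : ω.1 = Ordinal.omega0.toZFSet) :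
    ∃ ix : ↥M → ℕ, ∀ i : ℕ, ∃ n : ↥M, n.1 ∈ ω.1 ∧ ix n = i := by
  classical
  refine ⟨fun x => if h : ∃ i : ℕ, x.1 = (i : Ordinal).toZFSet then h.choose else 0, fun i => ?_⟩
  have hi : (i : Ordinal).toZFSet ∈ ω.1 := by
    rw [hω, Ordinal.toZFSet_mem_toZFSet_iff]
    exact Ordinal.natCast_lt_omega0 i
  refine ⟨⟨_, hT _ ω.2 _ hi⟩, hi, ?_⟩
  have hex : ∃ k : ℕ, (i : Ordinal.{u}).toZFSet = (k : Ordinal).toZFSet := ⟨i, rfl⟩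
  have := Ordinal.toZFSet_injective hex.choose_spec
  simp only [hex, dif_pos]
  exact_mod_cast this.symm

theorem subset_map (hT : SetTransitive M) (j : ↥M ↪ₑ[ZFLang] ↥M) {x : ↥M}
    (hx : x.1.IsOrdinal) : x.1 ⊆ (j x).1 := by
  have wf : WellFounded (fun x y : ↥M => x.1 ∈ y.1) := InvImage.wf Subtype.val ZFSet.mem_wf
  induction x using wf.induction with
  | _ x ih =>
    by_contra hn
    have hlt := (hx.not_subset_iff_mem (isOrdinal_map hT j hx)).1 hn
    exact ZFSet.mem_irrefl _ (ih (j x) hlt (hx.mem hlt) ((map_mem_iff j _ _).2 hlt))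

/-- `c` restricted to `ω` is a function into `β` with cofinal range. -/
def CofFun (β ω c : ↥M) : Prop :=
  SingleValued ω c ∧ (∀ n : ↥M, n.1 ∈ ω.1 → ∃ y : ↥M, y.1 ∈ β.1 ∧ App c n y) ∧ CofSeq β ω c

instance Dfn.cofFun {n : ℕ} (i k l : Fin n) :
    Dfn (M := M) fun v => CofFun (v i) (v k) (v l) := by
  unfold CofFun
  infer_instance

/-- Every function on `μ` has a closure point `β > α` of cofinality at most `ω` such that
the `β`-th member of `f` takes the value `ν` at `α`. -/
def Recurs (α ν μ f ω : ↥M) : Prop :=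
  ∀ g : ↥M, SingleValued μ g → (∀ ξ : ↥M, ξ.1 ∈ μ.1 → ∃ η : ↥M, η.1 ∈ μ.1 ∧ App g ξ η) →
    ∃ β : ↥M, β.1 ∈ μ.1 ∧ α.1 ∈ β.1 ∧ App₂ f β α ν ∧ (∃ c : ↥M, CofFun β ω c) ∧
      ∀ ξ : ↥M, ξ.1 ∈ β.1 → ∀ η : ↥M, App g ξ η → η.1 ∈ β.1

instance Dfn.recurs {n : ℕ} (i k l m p : Fin n) :
    Dfn (M := M) fun v => Recurs (v i) (v k) (v l) (v m) (v p) := by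
  unfold Recurs
  infer_instance

theorem SuccOf.exists_recurs (hT : SetTransitive M) {σ μ L ω : ↥M} (h : SuccOf σ μ)
    (hL : SeqClosed L) (hμL : μ.1 ⊆ L.1) (hω : ω.1 = Ordinal.omega0.toZFSet)
    (hωσ : ω.1 ⊆ σ.1) {f : ↥M} (hf : ∀ β : ↥M, β.1 ∈ μ.1 → ∀ α : ↥M, α.1 ∈ β.1 →
      ∃ ν : ↥M, ν.1 ∈ σ.1 ∧ App₂ f β α ν) {α : ↥M} (hα : α.1 ∈ μ.1) :
    ∃ ν : ↥M, ν.1 ∈ σ.1 ∧ Recurs α ν μ f ω := by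
  classical
  by_contra! hno
  have hno' : ∀ ν : ↥M, ν.1 ∈ σ.1 → ∃ G : ↥M → ↥M, (∀ ξ : ↥M, ξ.1 ∈ μ.1 → (G ξ).1 ∈ μ.1) ∧
      ∀ β : ↥M, β.1 ∈ μ.1 → α.1 ∈ β.1 → App₂ f β α ν → (∃ c : ↥M, CofFun β ω c) →
        ∃ ξ : ↥M, ξ.1 ∈ β.1 ∧ (G ξ).1 ∉ β.1 := by
    intro ν hν
    have := hno ν hν
    unfold Recurs at this
    push Not at this
    obtain ⟨g, hgs, hgt, hg⟩ := this
    choose! G hG hGg using hgt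
    refine ⟨G, hG, fun β hβ hαβ hfβ ⟨c, hc⟩ => ?_⟩
    obtain ⟨ξ, hξ, η, hη, hηβ⟩ := hg β hβ hαβ hfβ ⟨c, hc⟩
    have hξμ := h.isOrdinal.mem_trans hξ hβ
    refine ⟨ξ, hξ, ?_⟩
    rwa [hgs ξ hξμ _ _ (hGg ξ hξμ) hη]
  choose! G hG hGn using hno'
  have hb : ∀ ξ : ↥M, ξ.1 ∈ μ.1 → ∃ b : ↥M, b.1 ∈ μ.1 ∧ ∀ ν : ↥M, ν.1 ∈ σ.1 → (G ν ξ).1 ∈ b.1 :=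
    fun ξ hξ => h.exists_bound (fun ν => G ν ξ) fun ν hν => hG ν hν ξ hξ
  choose! b hbμ hbG using hb
  have hnx : ∀ β : ↥M, β.1 ∈ μ.1 → ∃ ζ : ↥M, ζ.1 ∈ μ.1 ∧ β.1 ∈ ζ.1 ∧
      ∀ ξ : ↥M, ξ.1 ∈ β.1 → (b ξ).1 ∈ ζ.1 := by
    intro β hβ
    obtain ⟨β', hβ', hlt⟩ := h.limit β hβ
    obtain ⟨ζ, hζ, hbd⟩ := h.exists_bound_of_mem hβ' (fun ξ => if ξ = β then β else b ξ)
      fun ξ hξ => by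
        split_ifs
        · exact hβ
        · exact hbμ ξ (h.isOrdinal.mem_trans hξ hβ')
    refine ⟨ζ, hζ, by simpa using hbd β hlt, fun ξ hξ => ?_⟩
    have hne : ξ ≠ β := by
      rintro rfl
      exact ZFSet.mem_irrefl _ hξ
    simpa [hne] using hbd ξ ((h.isOrdinal.mem hβ').mem_trans hξ hlt)
  choose! nx hnxμ hnxlt hnxb using hnx
  obtain ⟨α₀, hα₀, hαlt⟩ := h.limit α hα
  let B : ℕ → ↥M := fun i => nx^[i] α₀
  have hBs : ∀ i, B (i + 1) = nx (B i) := fun i => Function.iterate_succ_apply' nx i α₀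
  have hBμ : ∀ i, (B i).1 ∈ μ.1 := by
    intro i
    induction i with
    | zero => exact hα₀
    | succ i ih =>
      rw [hBs]
      exact hnxμ _ ih
  obtain ⟨ix, hix⟩ := exists_index hT hω
  obtain ⟨γ, hγμ, hBγ, hγB⟩ := exists_strict_sup hT h.isOrdinal B (by
    obtain ⟨ζ, hζ, hbd⟩ := h.exists_bound (fun n => B (ix n)) fun n _ => hBμ _
    refine ⟨ζ, hζ, fun i => ?_⟩
    obtain ⟨n, hn, rfl⟩ := hix i
    exact hbd n (hωσ hn))
  have hγo := h.isOrdinal.mem hγμ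
  have hαγ : α.1 ∈ γ.1 := hγo.mem_trans hαlt (hBγ 0)
  obtain ⟨ν, hν, hfν⟩ := hf γ hγμ α hαγ
  obtain ⟨c, hc⟩ := hL fun n => B (ix n)
  have hωL : ω.1 ⊆ L.1 := fun x hx => hμL (h.subset (hωσ hx))
  obtain ⟨ξ, hξ, hξG⟩ := hGn ν hν γ hγμ hαγ hfν ⟨c, fun n _ θ θ' h₁ h₂ =>
      ((hc _ _).1 h₁).2.trans ((hc _ _).1 h₂).2.symm,
    fun n hn => ⟨_, hBγ (ix n), (hc _ _).2 ⟨hωL hn, rfl⟩⟩, fun η hη => by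
      obtain ⟨i, hi⟩ := hγB η hη
      obtain ⟨n, hn, rfl⟩ := hix i
      refine ⟨n, hn, _, hBγ (ix n), (hc _ _).2 ⟨hωL hn, rfl⟩, ?_⟩
      rw [Subtype.ext_iff]
      exact (((hγo.mem hη).subset_iff_eq_or_mem (hγo.mem (hBγ _))).1 hi).symm⟩
  obtain ⟨i, hi⟩ := hγB ξ hξ
  have hξi : ξ.1 ∈ (B (i + 1)).1 := by
    rw [hBs]
    exact (hγo.mem hξ).mem_of_subset_of_mem (h.isOrdinal.mem (hnxμ _ (hBμ i))) hi
      (hnxlt _ (hBμ i))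
  have hbξ : (b ξ).1 ∈ γ.1 := by
    refine hγo.mem_trans (hnxb _ (hBμ (i + 1)) ξ hξi) ?_
    rw [← hBs]
    exact hBγ _
  exact hξG (hγo.mem_trans (hbG ξ (h.isOrdinal.mem_trans hξ hγμ) ν hν) hbξ)

end Stationary

section Inconsistency

variable {M : Set ZFSet.{u}}

/-- There is no fixed point `σ ≥ κ` of `j` whose cardinal successor is at most `L`. -/
theorem Moves.map_ne_self (hT : SetTransitive M) (hO : ∀ x : ZFSet.{u}, x.IsOrdinal → x ∈ M)
    {j : ↥M ↪ₑ[ZFLang] ↥M} {κ L σ : ↥M} (h : Moves j κ) (hL : SeqClosed L)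
    (hreg : RegularCard L.1) (hσL : σ.1 ∈ L.1) (hκσ : κ.1 ⊆ σ.1) : j σ ≠ σ := by
  intro hjσ
  let ω : ↥M := ⟨Ordinal.omega0.toZFSet, hO _ (ZFSet.isOrdinal_toZFSet _)⟩
  have hωκ : ω.1 ∈ κ.1 := h.omega_mem hT
  have hjω : j ω = ω := h.fix ω hωκ
  have hωσ : ω.1 ⊆ σ.1 := fun x hx => hκσ (h.isOrdinal.mem_trans hx hωκ)
  have hfixω : ∀ n : ↥M, n.1 ∈ ω.1 → j n = n := fun n hn =>
    h.fix n (h.isOrdinal.mem_trans hn hωκ)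
  obtain ⟨μ, hμ, hμL⟩ := exists_succOf hT hO hreg hσL hωσ
  choose! e he heinj using hμ.inj
  obtain ⟨f, hf⟩ := hL.exists_app₂ e
  have hval : ∀ β : ↥M, β.1 ∈ μ.1 → ∀ α : ↥M, α.1 ∈ β.1 →
      ∃ ν : ↥M, ν.1 ∈ σ.1 ∧ App₂ f β α ν := fun β hβ α hα =>
    ⟨e β α, he β hβ α hα, (hf _ _ _).2 ⟨hμL hβ, hμL (hμ.isOrdinal.mem_trans hα hβ), rfl⟩⟩
  have hinj : ∀ β : ↥M, β.1 ∈ μ.1 → ∀ α α' : ↥M, α.1 ∈ β.1 → α'.1 ∈ β.1 →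
      ∀ ν : ↥M, App₂ f β α ν → App₂ f β α' ν → α = α' := fun β hβ α α' hα hα' ν h₁ h₂ =>
    heinj β hβ α α' hα hα' (((hf _ _ _).1 h₁).2.2.symm.trans ((hf _ _ _).1 h₂).2.2)
  have hval' := (transfer₃ j (fun μ σ f => ∀ β : ↥M, β.1 ∈ μ.1 → ∀ α : ↥M, α.1 ∈ β.1 →
      ∃ ν : ↥M, ν.1 ∈ σ.1 ∧ App₂ f β α ν) μ σ f).2 hval
  have hinj' := (transfer₂ j (fun μ f => ∀ β : ↥M, β.1 ∈ μ.1 →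
      ∀ α α' : ↥M, α.1 ∈ β.1 → α'.1 ∈ β.1 →
      ∀ ν : ↥M, App₂ f β α ν → App₂ f β α' ν → α = α') μ f).2 hinj
  have hjμ : j μ = μ := by
    rcases (hμ.isOrdinal.subset_iff_eq_or_mem (isOrdinal_map hT j hμ.isOrdinal)).1
      (subset_map hT j hμ.isOrdinal) with heq | hlt
    · exact (Subtype.ext heq).symm
    · have hp := hval' μ hlt
      rw [hjσ] at hp
      choose! p hpσ hp using hp
      obtain ⟨α, α', hα, hα', hpp, -, hne⟩ :=
        hμ.not_inj p p fun α hα => ⟨hpσ α hα, hpσ α hα⟩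
      refine absurd (hinj' μ hlt α α' hα hα' (p α) (hp α hα) ?_) hne
      rw [hpp]
      exact hp α' hα'
  choose! s hsσ hsR using fun (α : ↥M) (hα : α.1 ∈ μ.1) =>
    hμ.exists_recurs hT hL hμL (ω := ω) rfl hωσ hval hα
  obtain ⟨ν, E, hE, hEinj⟩ : ∃ (ν : ↥M) (E : {i : ↥M // i.1 ∈ κ.1} → ↥M),
      (∀ i, (E i).1 ∈ μ.1 ∧ s (E i) = ν) ∧ Function.Injective E := by
    by_contra! hno
    have hq : ∀ ν : ↥M, ∃ q : {α : ↥M // α.1 ∈ μ.1 ∧ s α = ν} → {i : ↥M // i.1 ∈ κ.1},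
        Function.Injective q := by
      intro ν
      rcases Function.Embedding.total {α : ↥M // α.1 ∈ μ.1 ∧ s α = ν} {i : ↥M // i.1 ∈ κ.1}
        with ⟨⟨q⟩⟩ | ⟨⟨q⟩⟩
      · exact ⟨q, q.injective⟩
      · exact absurd (Subtype.val_injective.comp q.injective)
          (hno ν (fun i => (q i).1) fun i => (q i).2)
    choose q hq using hq
    classical
    obtain ⟨α, α', hα, hα', h₁, h₂, hne⟩ := hμ.not_inj s
      (fun α => if hα : α.1 ∈ μ.1 then (q (s α) ⟨α, hα, rfl⟩).1 else α) fun α hα => by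
        refine ⟨hsσ α hα, ?_⟩
        simpa [hα] using hκσ (q (s α) ⟨α, hα, rfl⟩).2
    have key : ∀ ν (hν : s α = ν) (hν' : s α' = ν),
        (q ν ⟨α, hα, hν⟩).1 = (q ν ⟨α', hα', hν'⟩).1 → False := fun ν hν hν' he =>
      hne (congrArg Subtype.val (hq ν (Subtype.ext he)))
    refine key (s α') h₁ rfl ?_
    simp only [hα, hα', dif_pos] at h₂
    have hcast : ∀ ν (hν : s α = ν), (q ν ⟨α, hα, hν⟩).1 = (q (s α) ⟨α, hα, rfl⟩).1 := by
      rintro _ rfl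
      rfl
    exact (hcast _ h₁).trans h₂
  classical
  obtain ⟨t, ht⟩ := hL fun i => if hi : i.1 ∈ κ.1 then E ⟨i, hi⟩ else i
  have hκL : κ.1 ⊆ L.1 := fun x hx => hreg.1.mem_trans (hκσ hx) hσL
  have ht' : ∀ (i : ↥M) (hi : i.1 ∈ κ.1) (y : ↥M), App t i y ↔ y = E ⟨i, hi⟩ := by
    intro i hi y
    rw [ht]
    simp [hi, hκL hi]
  have htinj : ∀ i i' : ↥M, i.1 ∈ κ.1 → i'.1 ∈ κ.1 → ∀ α : ↥M, App t i α → App t i' α →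
      i = i' := by
    intro i i' hi hi' α h₁ h₂
    rw [ht' i hi] at h₁
    rw [ht' i' hi'] at h₂
    exact congrArg Subtype.val (hEinj (h₁.symm.trans h₂))
  have htinj' := (transfer₂ j (fun κ t => ∀ i i' : ↥M, i.1 ∈ κ.1 → i'.1 ∈ κ.1 →
    ∀ α : ↥M, App t i α → App t i' α → i = i') κ t).2 htinj
  have hrec : ∀ i : ↥M, i.1 ∈ κ.1 → ∃ α : ↥M, App t i α ∧ Recurs α ν μ f ω := by
    intro i hi
    refine ⟨_, (ht' i hi _).2 rfl, ?_⟩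
    have := hsR _ (hE ⟨i, hi⟩).1
    rwa [(hE ⟨i, hi⟩).2] at this
  obtain ⟨α, htα, hα⟩ := (transfer₆ j (fun κ t ν μ f ω => ∀ i : ↥M, i.1 ∈ κ.1 →
    ∃ α : ↥M, App t i α ∧ Recurs α ν μ f ω) κ t ν μ f ω).2 hrec κ h.mem_map
  rw [hjμ, hjω] at hα
  obtain ⟨g, hg⟩ := hL j
  obtain ⟨β, hβ, hαβ, hfβ, ⟨c, hcs, hct, hcc⟩, hcl⟩ := hα g
    (fun ξ _ θ θ' h₁ h₂ => ((hg _ _).1 h₁).2.trans ((hg _ _).1 h₂).2.symm)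
    fun ξ hξ => ⟨j ξ, hjμ ▸ (map_mem_iff j _ _).2 hξ, (hg _ _).2 ⟨hμL hξ, rfl⟩⟩
  have hβo := hμ.isOrdinal.mem hβ
  have hclj : ∀ ξ : ↥M, ξ.1 ∈ β.1 → (j ξ).1 ∈ β.1 := fun ξ hξ =>
    hcl ξ hξ _ ((hg _ _).2 ⟨hμL (hμ.isOrdinal.mem_trans hξ hβ), rfl⟩)
  have hjβ : j β = β := by
    rcases (hβo.subset_iff_eq_or_mem (isOrdinal_map hT j hβo)).1 (subset_map hT j hβo)
      with heq | hlt
    · exact (Subtype.ext heq).symm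
    · have hcs' := (transfer₂ j SingleValued ω c).2 hcs
      obtain ⟨n, hn, θ, hθ, hcθ, hle⟩ := (transfer₃ j CofSeq β ω c).2 hcc β hlt
      rw [hjω] at hn hcs'
      obtain ⟨y, hy, hcy⟩ := hct n hn
      have hcy' := (app_map_iff j c n y).2 hcy
      rw [hfixω n hn] at hcy'
      have hθβ : θ.1 ∈ β.1 := by
        rw [hcs' n hn _ _ hcθ hcy']
        exact hclj y hy
      rcases hle with hle | rfl
      · exact (ZFSet.mem_asymm hle hθβ).elim
      · exact (ZFSet.mem_irrefl _ hθβ).elim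
  obtain ⟨α', hα', hfα'⟩ := (transfer₃ j (fun β f ν => ∃ α : ↥M, α.1 ∈ β.1 ∧ App₂ f β α ν)
    β f ν).1 ⟨α, by rwa [hjβ], by rwa [hjβ]⟩
  have hfα := (app₂_map_iff j f β α' ν).2 hfα'
  rw [hjβ] at hfα
  obtain rfl : α = j α' := hinj' β (hjμ.symm ▸ hβ) α (j α') hαβ (hclj _ hα') (j ν) hfβ hfα
  obtain ⟨i, hi, hti⟩ := (transfer₃ j (fun κ t α => ∃ i : ↥M, i.1 ∈ κ.1 ∧ App t i α)
    κ t α').1 ⟨κ, h.mem_map, htα⟩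
  have hti' := (app_map_iff j t i α').2 hti
  have hji := (map_mem_iff j i κ).2 hi
  rw [h.fix i hi] at hti' hji
  have hκi := htinj' κ i h.mem_map hji (j α') htα hti'
  rw [← hκi] at hi
  exact ZFSet.mem_irrefl _ hi

theorem Moves.exists_fixed (hT : SetTransitive M) {j : ↥M ↪ₑ[ZFLang] ↥M} {κ L : ↥M}
    (h : Moves j κ) (hL : SeqClosed L) (hreg : RegularCard L.1)
    (hit : ∀ i : ℕ, (j^[i] κ).1 ∈ L.1) : ∃ σ : ↥M, σ.1 ∈ L.1 ∧ κ.1 ⊆ σ.1 ∧ j σ = σ := by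
  have hωκ := h.omega_mem hT
  obtain ⟨ω, hω⟩ : ∃ ω : ↥M, ω.1 = Ordinal.omega0.toZFSet := ⟨⟨_, hT _ κ.2 _ hωκ⟩, rfl⟩
  rw [← hω] at hωκ
  have hjω : j ω = ω := h.fix ω hωκ
  have hfixω : ∀ n : ↥M, n.1 ∈ ω.1 → j n = n := fun n hn =>
    h.fix n (h.isOrdinal.mem_trans hn hωκ)
  have hκL : κ.1 ⊆ L.1 := hreg.1.subset_of_mem (hit 0)
  have hωL : ω.1 ∈ L.1 := hκL hωκ
  obtain ⟨ix, hix⟩ := exists_index hT hω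
  obtain ⟨σ, hσL, hσ, hσmin⟩ := exists_strict_sup hT hreg.1 (fun i : ℕ => j^[i] κ) (by
    obtain ⟨ζ, hζ, hb⟩ := hreg.exists_bound_subtype hT hωL (fun n => j^[ix n] κ) fun n _ => hit _
    refine ⟨ζ, hζ, fun i => ?_⟩
    obtain ⟨n, hn, rfl⟩ := hix i
    exact hb n hn)
  have hσo := hreg.1.mem hσL
  refine ⟨σ, hσL, hσo.subset_of_mem (hσ 0), ?_⟩
  obtain ⟨K, hK⟩ := hL fun n => j^[ix n] κ
  have hKs : SingleValued ω K := fun n _ θ θ' h₁ h₂ =>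
    ((hK _ _).1 h₁).2.trans ((hK _ _).1 h₂).2.symm
  have hKs' := (transfer₂ j SingleValued ω K).2 hKs
  have hcov : ∀ z : ↥M, z.1 ∈ σ.1 → ∃ n y : ↥M, n.1 ∈ ω.1 ∧ App K n y ∧
      (z.1 ∈ y.1 ∨ z = y) := by
    intro z hz
    obtain ⟨i, hi⟩ := hσmin z hz
    obtain ⟨n, hn, rfl⟩ := hix i
    refine ⟨n, _, hn, (hK _ _).2 ⟨hreg.1.mem_trans hn hωL, rfl⟩, ?_⟩
    rw [Subtype.ext_iff]
    exact (((hσo.mem hz).subset_iff_eq_or_mem (hσo.mem (hσ _))).1 hi).symm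
  have hcov' := (transfer₃ j (fun σ ω K => ∀ z : ↥M, z.1 ∈ σ.1 → ∃ n y : ↥M, n.1 ∈ ω.1 ∧
    App K n y ∧ (z.1 ∈ y.1 ∨ z = y)) σ ω K).2 hcov
  rw [hjω] at hcov' hKs'
  rcases (hσo.subset_iff_eq_or_mem (isOrdinal_map hT j hσo)).1 (subset_map hT j hσo)
    with heq | hlt
  · exact (Subtype.ext heq).symm
  · obtain ⟨n, y, hn, hKy, hle⟩ := hcov' σ hlt
    have hKn := (app_map_iff j K n (j^[ix n] κ)).2
      ((hK _ _).2 ⟨hreg.1.mem_trans hn hωL, rfl⟩)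
    rw [hfixω n hn, ← Function.iterate_succ_apply' j] at hKn
    have hy := hσ (ix n + 1)
    rw [← hKs' n hn _ _ hKy hKn] at hy
    rcases hle with hle | rfl
    · exact (ZFSet.mem_asymm hle hy).elim
    · exact (ZFSet.mem_irrefl _ hy).elim

/-- The critical sequence is not bounded by `L`. -/
theorem Moves.exists_iterate_notMem (hT : SetTransitive M)
    (hO : ∀ x : ZFSet.{u}, x.IsOrdinal → x ∈ M) {j : ↥M ↪ₑ[ZFLang] ↥M} {κ L : ↥M}
    (h : Moves j κ) (hL : SeqClosed L) (hreg : RegularCard L.1) :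
    ∃ i : ℕ, (j^[i] κ).1 ∉ L.1 := by
  by_contra! hit
  obtain ⟨σ, hσL, hκσ, hjσ⟩ := h.exists_fixed hT hL hreg hit
  exact h.map_ne_self hT hO hL hreg hσL hκσ hjσ

/-- Composing `j` with itself, we obtain an embedding with the same critical point that moves
it above `L`. -/
theorem Moves.exists_mem_map (hT : SetTransitive M) (hO : ∀ x : ZFSet.{u}, x.IsOrdinal → x ∈ M)
    {j : ↥M ↪ₑ[ZFLang] ↥M} {κ L : ↥M} (h : Moves j κ) (hL : SeqClosed L)
    (hreg : RegularCard L.1) : ∃ k : ↥M ↪ₑ[ZFLang] ↥M, Moves k κ ∧ L.1 ∈ (k κ).1 := by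
  have hpow : ∀ i : ℕ, ∃ k : ↥M ↪ₑ[ZFLang] ↥M, ∀ x, k x = j^[i + 1] x := by
    intro i
    induction i with
    | zero => exact ⟨j, fun x => rfl⟩
    | succ i ih =>
      obtain ⟨k, hk⟩ := ih
      refine ⟨j.comp k, fun x => ?_⟩
      rw [Function.iterate_succ_apply', ← hk]
      rfl
  have hord : ∀ i : ℕ, (j^[i] κ).1.IsOrdinal := by
    intro i
    induction i with
    | zero => exact h.isOrdinal
    | succ i ih =>
      rw [Function.iterate_succ_apply']
      exact isOrdinal_map hT j ih
  have hstep : ∀ i : ℕ, (j^[i] κ).1 ∈ (j^[i + 1] κ).1 := by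
    intro i
    induction i with
    | zero => exact h.mem_map
    | succ i ih =>
      have := (map_mem_iff j _ _).2 ih
      rwa [← Function.iterate_succ_apply' j, ← Function.iterate_succ_apply' j] at this
  have hmem : ∀ i : ℕ, κ.1 ∈ (j^[i + 1] κ).1 := by
    intro i
    induction i with
    | zero => exact h.mem_map
    | succ i ih => exact (hord _).mem_trans ih (hstep _)
  obtain ⟨i, hi⟩ := h.exists_iterate_notMem hT hO hL hreg
  obtain ⟨k, hk⟩ := hpow i
  refine ⟨k, ⟨h.isOrdinal, fun β hβ => ?_, ?_⟩, ?_⟩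
  · rw [hk]
    exact Function.iterate_fixed (h.fix β hβ) _
  · rw [hk]
    exact hmem i
  · rw [hk]
    exact hreg.1.mem_of_subset_of_mem (hord _) (((hord i).notMem_iff_subset hreg.1).1 hi)
      (hstep i)

end Inconsistency

section SmallSubsets

variable {M : Set ZFSet.{u}}

open Cardinal in
theorem Moves.card_smallSubsets_le (hT : SetTransitive M)
    {j : ↥M ↪ₑ[ZFLang] ↥M} {κ L : ↥M} (h : Moves j κ)
    (hL : SeqClosed L) (hreg : RegularCard L.1) (hκL : κ.1 ∈ L.1 ∨ κ = L)
    (hLj : L.1 ∈ (j κ).1) : (SmallSubsets κ.1 L.1).card ≤ L.1.card := by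
  have hκsub : κ.1 ⊆ L.1 := by
    rcases hκL with hκL | rfl
    · exact hreg.1.subset_of_mem hκL
    · exact subset_rfl
  have hinf : ℵ₀ ≤ L.1.card := by
    have := ZFSet.card_mono (h.isOrdinal.subset_of_mem (h.omega_mem hT))
    rw [Ordinal.card_toZFSet, Ordinal.card_omega0] at this
    exact this.trans (ZFSet.card_mono hκsub)
  obtain ⟨b, N, hbN, hcov⟩ := h.exists_cover hT hL hreg hκL hLj
  have hex : ∀ s ∈ SmallSubsets κ.1 L.1, ∃ α : ↥M, α.1 ∈ L.1 ∧
      ∀ x : ↥M, x.1 ∈ s → x ∈ N α := by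
    classical
    intro s hs
    obtain ⟨hsL, β, hβ, f, hf⟩ := ZFSet.mem_sep.1 hs
    rw [ZFSet.mem_powerset] at hsL
    choose! F hF _ using hf.1.2
    obtain ⟨α, hα, hN⟩ := hcov ⟨β, hT _ κ.2 _ hβ⟩ hβ
      (fun i => if hi : ∃ x : ↥M, x.1 ∈ s ∧ F x.1 = i.1 then hi.choose
        else ⟨∅, hT _ κ.2 _ (h.empty_mem hT)⟩) fun i _ => by
          split_ifs with hi
          · exact hsL hi.choose_spec.1
          · exact hκsub (h.empty_mem hT)
    refine ⟨α, hα, fun x hx => ?_⟩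
    have hFx := (ZFSet.pair_mem_prod.1 (hf.1.1 (hF x.1 hx))).2
    have hi : ∃ y : ↥M, y.1 ∈ s ∧ F y.1 = F x.1 := ⟨x, hx, rfl⟩
    have hmem := hN ⟨F x.1, hT _ (hT _ κ.2 _ hβ) _ hFx⟩ hFx
    rw [dif_pos hi] at hmem
    have hxy : x = hi.choose := by
      refine Subtype.ext (hf.2 _ _ (F x.1) (hF _ hx) ?_)
      have := hF _ hi.choose_spec.1
      rwa [hi.choose_spec.2] at this
    rwa [← hxy] at hmem
  have : Nonempty ↥M := ⟨κ⟩
  choose! A hA hAN using hex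
  have hq : ∀ α : ↥M, ∃ q : Set (N α) → {i : ↥M // i.1 ∈ L.1}, Function.Injective q := by
    intro α
    have hlt : #(Set (N α)) ≤ #{i : ↥M // i.1 ∈ L.1} := by
      rw [Cardinal.mk_set, mk_subtype_mem hT]
      refine (Cardinal.power_le_power_left two_ne_zero (hbN α).2).trans ?_
      rw [← Cardinal.lift_two_power, Cardinal.lift_le]
      exact (h.two_power_card_lt hT hL hκsub (hbN α).1).le.trans (ZFSet.card_mono hκsub)
    obtain ⟨q⟩ := Cardinal.le_def _ _ |>.1 hlt
    exact ⟨q, q.injective⟩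
  choose q hq using hq
  have hle : #{s // s ∈ SmallSubsets κ.1 L.1} ≤
      #({i : ↥M // i.1 ∈ L.1} × {i : ↥M // i.1 ∈ L.1}) := by
    refine Cardinal.mk_le_of_injective
      (f := fun s => (⟨A s, hA s s.2⟩, q (A s) {x | x.1.1 ∈ s.1})) ?_
    rintro ⟨s, hs⟩ ⟨t, ht⟩ he
    simp only [Prod.mk.injEq, Subtype.mk.injEq] at he
    obtain ⟨hA', hq'⟩ := he
    have hst : ∀ x : ↥M, x ∈ N (A s) → (x.1 ∈ s ↔ x.1 ∈ t) := by
      rw [← hA'] at hq'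
      exact fun x hx => Set.ext_iff.1 (hq _ hq') ⟨x, hx⟩
    have hsub : ∀ s ∈ SmallSubsets κ.1 L.1, s ⊆ L.1 := fun s hs =>
      ZFSet.mem_powerset.1 (ZFSet.mem_sep.1 hs).1
    refine Subtype.ext (ZFSet.ext fun z => ⟨fun hz => ?_, fun hz => ?_⟩)
    · have hzM := hT _ L.2 _ (hsub s hs hz)
      exact (hst ⟨z, hzM⟩ (hAN s hs ⟨z, hzM⟩ hz)).1 hz
    · have hzM := hT _ L.2 _ (hsub t ht hz)
      exact (hst ⟨z, hzM⟩ (hA' ▸ hAN t ht ⟨z, hzM⟩ hz)).2 hz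
  rwa [ZFSet.cardinalMk_coe_sort, mk_prod, Cardinal.lift_id, mk_subtype_mem hT, ← Cardinal.lift_mul,
    Cardinal.lift_le, Cardinal.mul_eq_self hinf] at hle

/-- A singleton is a small subset. -/
theorem Moves.le_card_smallSubsets (hT : SetTransitive M)
    {j : ↥M ↪ₑ[ZFLang] ↥M} {κ L : ↥M} (h : Moves j κ) :
    L.1.card ≤ (SmallSubsets κ.1 L.1).card := by
  rw [← Cardinal.lift_le.{u + 1}, ← ZFSet.cardinalMk_coe_sort, ← ZFSet.cardinalMk_coe_sort]
  refine Cardinal.mk_le_of_injective (f := fun ξ => ⟨{ξ.1}, ?_⟩) fun ξ ζ he => ?_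
  · refine ZFSet.mem_sep.2 ⟨?_, _, h.omega_mem hT, exists_injZFunc ?_⟩
    · rw [ZFSet.mem_powerset]
      intro x hx
      rw [ZFSet.mem_singleton] at hx
      exact hx ▸ ξ.2
    · rw [ZFSet.card_singleton, Ordinal.card_toZFSet, Ordinal.card_omega0]
      exact Cardinal.one_le_aleph0
  · exact Subtype.ext (ZFSet.singleton_injective (congrArg Subtype.val he))

theorem Moves.card_smallSubsets (hT : SetTransitive M)
    (hO : ∀ x : ZFSet.{u}, x.IsOrdinal → x ∈ M)
    {j : ↥M ↪ₑ[ZFLang] ↥M} {κ L : ↥M} (h : Moves j κ)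
    (hL : SeqClosed L) (hreg : RegularCard L.1) (hκL : κ.1 ∈ L.1 ∨ κ = L) :
    (SmallSubsets κ.1 L.1).card = L.1.card := by
  obtain ⟨k, hk, hLk⟩ := h.exists_mem_map hT hO hL hreg
  exact le_antisymm (hk.card_smallSubsets_le hT hL hreg hκL hLk) (hk.le_card_smallSubsets hT)

end SmallSubsets

/-- if `λ` is regular, `M` is a `λ`-closed transitive class model of ZFC,
and `j : M → M` is a nontrivial elementary embedding with critical point `κ ≤ λ`, then
`λ^{<κ} = λ`, i.e. `P_κ(λ)` is equinumerous with `λ`. -/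
theorem stmt1 (M : Set ZFSet) (hM : IsZFCModel M)
    (hOrds : ∀ x : ZFSet, x.IsOrdinal → x ∈ M)
    (lam : ZFSet) (hreg : RegularCard lam) (hcl : LambdaClosed lam M)
    (j : ↥M ↪ₑ[ZFLang] ↥M)
    (hnt : ∃ x : ↥M, ((j x : ↥M) : ZFSet) ≠ (x : ZFSet))
    (κ : ZFSet) (hκ : IsCrit M M (⇑j) κ) (hkl : κ ∈ lam ∨ κ = lam) :
    Equinumerous (SmallSubsets κ lam) lam := by
  have hT := hM.1
  obtain ⟨hκM, hmv⟩ := hκ.moves hT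
  exact equinumerous_of_card_eq (hmv.card_smallSubsets (L := ⟨lam, hOrds lam hreg.1⟩) hT hOrds
    (hcl.seqClosed (L := ⟨lam, hOrds lam hreg.1⟩) hT) hreg
    (hkl.imp id fun h => Subtype.ext h))
end

section
/- If j : M → N is an amenable elementary embedding between transitive models of ZFC with the same ordinals, then M ⊆ N. -/
open FirstOrder FirstOrder.Language

section Realize

variable {M : Set ZFSet} {n : ℕ}

@[simp]
theorem realize_mem' (x y : Fin n) (v : Empty → M) (xs : Fin n → M) :
    (mem' x y).Realize v xs ↔ (xs x : ZFSet) ∈ (xs y : ZFSet) :=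
  BoundedFormula.realize_rel₂

@[simp]
theorem realize_eq' (x y : Fin n) (v : Empty → M) (xs : Fin n → M) :
    (eq' x y).Realize v xs ↔ xs x = xs y :=
  BoundedFormula.realize_bdEqual _ _

theorem realize_liftAt_two_one {k : ℕ} (φ : ZFLang.BoundedFormula Empty (k + 1)) (v : Fin k → M)
    (a b x : M) :
    (φ.liftAt 2 k).Realize default
        (Fin.snoc (Fin.snoc (Fin.snoc v a : Fin (k + 1) → M) b : Fin (k + 2) → M) x :
          Fin (k + 3) → M) ↔
      φ.Realize default (Fin.snoc v x : Fin (k + 1) → M) := by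
  refine (BoundedFormula.realize_liftAt (n := k + 1) (n' := 2) (by omega)).trans ?_
  refine iff_of_eq (congrArg _ (funext fun i => ?_))
  refine Fin.lastCases ?_ (fun i => ?_) i
  · simp [Fin.snoc]
  · have := i.2
    simp [Fin.snoc, show (i : ℕ) < k + 2 by omega]
    rfl

theorem realize_liftAt_two_two {k : ℕ} (φ : ZFLang.BoundedFormula Empty (k + 2)) (v : Fin k → M)
    (a b x y : M) :
    (φ.liftAt 2 k).Realize default
        (Fin.snoc (Fin.snoc (Fin.snoc (Fin.snoc v a : Fin (k + 1) → M) b : Fin (k + 2) → M) x :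
          Fin (k + 3) → M) y : Fin (k + 4) → M) ↔
      φ.Realize default (Fin.snoc (Fin.snoc v x : Fin (k + 1) → M) y : Fin (k + 2) → M) := by
  refine (BoundedFormula.realize_liftAt (n := k + 2) (n' := 2) (by omega)).trans ?_
  refine iff_of_eq (congrArg _ (funext fun i => ?_))
  refine Fin.lastCases ?_ (fun i => Fin.lastCases ?_ (fun i => ?_) i) i
  · simp [Fin.snoc]
  · simp [Fin.snoc]
  · have := i.2
    simp [Fin.snoc, show (i : ℕ) < k + 1 by omega, show (i : ℕ) < k + 2 by omega,
      show (i : ℕ) < k + 3 by omega]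
    rfl

end Realize

/-- The formula `z = {x, y}`. -/
def upairF {n : ℕ} (z x y : Fin n) : ZFLang.BoundedFormula Empty n :=
  ∀' (mem' (Fin.last n) z.castSucc ⇔
    (eq' (Fin.last n) x.castSucc ⊔ eq' (Fin.last n) y.castSucc))

/-- The formula `p = (x, y)`. -/
def opairF {n : ℕ} (p x y : Fin n) : ZFLang.BoundedFormula Empty n :=
  ∀' (mem' (Fin.last n) p.castSucc ⇔
    (upairF (Fin.last n) x.castSucc x.castSucc ⊔ upairF (Fin.last n) x.castSucc y.castSucc))

/-- The formula `(x, y) ∈ f`. -/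
def opairMemF {n : ℕ} (x y f : Fin n) : ZFLang.BoundedFormula Empty n :=
  ∃' (mem' (Fin.last n) f.castSucc ⊓ opairF (Fin.last n) x.castSucc y.castSucc)

/-- The formula saying that `f` is a bisimulation between `(s, ∈)` and the universe. -/
def bisimF {n : ℕ} (f s : Fin n) : ZFLang.BoundedFormula Empty n :=
  ∀' ∀' (opairMemF (Fin.last n).castSucc (Fin.last (n + 1)) f.castSucc.castSucc ⟹
    (∀' ((mem' (Fin.last (n + 2)) (Fin.last n).castSucc.castSucc ⊓
          mem' (Fin.last (n + 2)) s.castSucc.castSucc.castSucc) ⟹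
        ∃' (mem' (Fin.last (n + 3)) (Fin.last (n + 1)).castSucc.castSucc ⊓
          opairMemF (Fin.last (n + 2)).castSucc (Fin.last (n + 3))
            f.castSucc.castSucc.castSucc.castSucc))) ⊓
    (∀' (mem' (Fin.last (n + 2)) (Fin.last (n + 1)).castSucc ⟹
        ∃' ((mem' (Fin.last (n + 3)) (Fin.last n).castSucc.castSucc.castSucc ⊓
          mem' (Fin.last (n + 3)) s.castSucc.castSucc.castSucc.castSucc) ⊓
          opairMemF (Fin.last (n + 3)) (Fin.last (n + 2)).castSucc
            f.castSucc.castSucc.castSucc.castSucc))))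

/-- The set of pairs `f` is a bisimulation between `(s, ∈)` and the universe. -/
def IsBisim (f s : ZFSet) : Prop :=
  ∀ a b, ZFSet.pair a b ∈ f →
    (∀ c ∈ a, c ∈ s → ∃ d ∈ b, c.pair d ∈ f) ∧ (∀ c ∈ b, ∃ d ∈ a, d ∈ s ∧ d.pair c ∈ f)

namespace IsZFCModel

variable {M : Set ZFSet}

theorem mem_of_mem (hM : IsZFCModel M) {x y : ZFSet} (hx : x ∈ M) (hy : y ∈ x) : y ∈ M :=
  hM.1 x hx y hy

theorem sep_mem (hM : IsZFCModel M) {k : ℕ} (φ : ZFLang.BoundedFormula Empty (k + 1))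
    (v : Fin k → M) {a : ZFSet} (ha : a ∈ M) {P : ZFSet → Prop}
    (hP : ∀ x : M, φ.Realize default (Fin.snoc v x : Fin (k + 1) → M) ↔ P x) :
    a.sep P ∈ M := by
  have h := hM.2.realize_of_mem (sepAx φ)
    (.inl (.inr (Set.mem_iUnion.2 ⟨k, φ, rfl⟩)))
  rw [sepAx, Sentence.Realize, BoundedFormula.realize_alls] at h
  obtain ⟨b, hb⟩ := by simpa only [BoundedFormula.realize_ex] using h v ⟨a, ha⟩
  have key : ∀ x : M, (x : ZFSet) ∈ (b : ZFSet) ↔ (x : ZFSet) ∈ a ∧ P x := by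
    intro x
    have hx := hb x
    rw [BoundedFormula.realize_iff, BoundedFormula.realize_inf] at hx
    rw [← hP, ← realize_liftAt_two_one φ v ⟨a, ha⟩ b x]
    simpa [Fin.snoc] using hx
  convert b.2
  ext x
  rw [ZFSet.mem_sep]
  exact ⟨fun hx => (key ⟨x, hM.mem_of_mem ha hx.1⟩).2 hx,
    fun hx => (key ⟨x, hM.mem_of_mem b.2 hx⟩).1 hx⟩

theorem exists_coll (hM : IsZFCModel M) {k : ℕ} (φ : ZFLang.BoundedFormula Empty (k + 2))
    (v : Fin k → M) {a : ZFSet} (ha : a ∈ M) {P : ZFSet → ZFSet → Prop}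
    (hP : ∀ x y : M, φ.Realize default
      (Fin.snoc (Fin.snoc v x : Fin (k + 1) → M) y : Fin (k + 2) → M) ↔ P x y)
    (hex : ∀ x ∈ a, ∃ y ∈ M, P x y) :
    ∃ b ∈ M, ∀ x ∈ a, ∃ y ∈ b, P x y := by
  have h := hM.2.realize_of_mem (collAx φ)
    (.inr (Set.mem_iUnion.2 ⟨k, φ, rfl⟩))
  rw [collAx, Sentence.Realize, BoundedFormula.realize_alls] at h
  obtain ⟨b, hb⟩ := by simpa only [BoundedFormula.realize_ex] using h v ⟨a, ha⟩
  refine ⟨b, b.2, fun x hxa => ?_⟩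
  have hx := hb ⟨x, hM.mem_of_mem ha hxa⟩
  rw [BoundedFormula.realize_imp, BoundedFormula.realize_imp, BoundedFormula.realize_ex,
    BoundedFormula.realize_ex] at hx
  obtain ⟨y, hy⟩ := hx (by simpa [Fin.snoc] using hxa) (by
    obtain ⟨y, hyM, hy⟩ := hex x hxa
    exact ⟨⟨y, hyM⟩, (realize_liftAt_two_two φ v _ _ _ _).2 ((hP _ _).2 hy)⟩)
  rw [BoundedFormula.realize_inf] at hy
  exact ⟨y, by simpa [Fin.snoc] using hy.1,
    (hP ⟨x, _⟩ y).1 ((realize_liftAt_two_two φ v _ _ _ _).1 hy.2)⟩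

theorem upair_mem (hM : IsZFCModel M) {x y : ZFSet} (hx : x ∈ M) (hy : y ∈ M) :
    ({x, y} : ZFSet) ∈ M := by
  have h := hM.2.realize_of_mem pairAx (by simp [ZFCTheory])
  simp [pairAx, Sentence.Realize, Formula.Realize, Fin.snoc] at h
  obtain ⟨b, hb, h⟩ := h x hx y hy
  convert hb
  ext z
  rw [ZFSet.mem_pair]
  exact ⟨fun hz => (h z (by rcases hz with rfl | rfl <;> assumption)).2 hz,
    fun hz => (h z (hM.mem_of_mem hb hz)).1 hz⟩

theorem singleton_mem (hM : IsZFCModel M) {x : ZFSet} (hx : x ∈ M) : ({x} : ZFSet) ∈ M := by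
  simpa using hM.upair_mem hx hx

theorem sUnion_mem (hM : IsZFCModel M) {x : ZFSet} (hx : x ∈ M) : (ZFSet.sUnion x) ∈ M := by
  have h := hM.2.realize_of_mem unionAx (by simp [ZFCTheory])
  simp [unionAx, Sentence.Realize, Formula.Realize, Fin.snoc] at h
  obtain ⟨b, hb, h⟩ := h x hx
  convert hb
  ext z
  rw [ZFSet.mem_sUnion]
  refine ⟨fun ⟨w, hw, hz⟩ => ?_, fun hz => ?_⟩
  · have hwM := hM.mem_of_mem hx hw
    exact (h z (hM.mem_of_mem hwM hz)).2 ⟨w, hw, hwM, hz⟩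
  · obtain ⟨w, hw, -, hz⟩ := (h z (hM.mem_of_mem hb hz)).1 hz
    exact ⟨w, hw, hz⟩

theorem union_mem (hM : IsZFCModel M) {x y : ZFSet} (hx : x ∈ M) (hy : y ∈ M) : x ∪ y ∈ M := by
  simpa using hM.sUnion_mem (hM.upair_mem hx hy)

theorem pair_mem (hM : IsZFCModel M) {x y : ZFSet} (hx : x ∈ M) (hy : y ∈ M) : x.pair y ∈ M :=
  hM.upair_mem (hM.singleton_mem hx) (hM.upair_mem hx hy)

section Realize

variable {n : ℕ} {v : Empty → M} {xs : Fin n → M}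

theorem realize_upairF (hM : IsZFCModel M) {z x y : Fin n} :
    (upairF z x y).Realize v xs ↔ (xs z : ZFSet) = {(xs x : ZFSet), (xs y : ZFSet)} := by
  simp only [upairF, BoundedFormula.realize_all, BoundedFormula.realize_iff, realize_mem',
    BoundedFormula.realize_sup, realize_eq', Fin.snoc_last, Fin.snoc_castSucc,
    Subtype.ext_iff]
  rw [ZFSet.ext_iff]
  simp only [ZFSet.mem_pair]
  refine ⟨fun h w => ⟨fun hw => ?_, fun hw => ?_⟩, fun h w => h w⟩
  · exact (h ⟨w, hM.mem_of_mem (xs z).2 hw⟩).1 hw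
  · exact (h ⟨w, by rcases hw with rfl | rfl <;> exact Subtype.coe_prop _⟩).2 hw

theorem realize_opairF (hM : IsZFCModel M) {p x y : Fin n} :
    (opairF p x y).Realize v xs ↔ (xs p : ZFSet) = (xs x : ZFSet).pair (xs y) := by
  simp only [opairF, BoundedFormula.realize_all, BoundedFormula.realize_iff, realize_mem',
    BoundedFormula.realize_sup, hM.realize_upairF, Fin.snoc_last, Fin.snoc_castSucc]
  rw [ZFSet.pair, ZFSet.pair_eq_singleton, ZFSet.ext_iff]
  simp only [ZFSet.mem_pair]
  refine ⟨fun h w => ⟨fun hw => ?_, fun hw => ?_⟩, fun h w => h w⟩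
  · exact (h ⟨w, hM.mem_of_mem (xs p).2 hw⟩).1 hw
  · exact (h ⟨w, by
      rcases hw with rfl | rfl
      · exact hM.singleton_mem (xs x).2
      · exact hM.upair_mem (xs x).2 (xs y).2⟩).2 hw

theorem realize_opairMemF (hM : IsZFCModel M) {x y f : Fin n} :
    (opairMemF x y f).Realize v xs ↔ (xs x : ZFSet).pair (xs y) ∈ (xs f : ZFSet) := by
  simp only [opairMemF, BoundedFormula.realize_ex, BoundedFormula.realize_inf, realize_mem',
    hM.realize_opairF, Fin.snoc_last, Fin.snoc_castSucc]
  refine ⟨fun ⟨p, hp, h⟩ => h ▸ hp, fun h => ⟨⟨_, hM.mem_of_mem (xs f).2 h⟩, h, rfl⟩⟩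

theorem mem_of_pair_mem (hM : IsZFCModel M) {a b f : ZFSet} (hf : f ∈ M) (h : a.pair b ∈ f) :
    a ∈ M ∧ b ∈ M := by
  have h1 : ({a, b} : ZFSet) ∈ M :=
    hM.mem_of_mem (hM.mem_of_mem hf h) (ZFSet.mem_pair.2 (.inr rfl))
  exact ⟨hM.mem_of_mem h1 (by simp), hM.mem_of_mem h1 (by simp)⟩

theorem realize_bisimF (hM : IsZFCModel M) {f s : Fin n} :
    (bisimF f s).Realize v xs ↔ IsBisim (xs f) (xs s) := by
  simp only [bisimF, BoundedFormula.realize_all, BoundedFormula.realize_ex,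
    BoundedFormula.realize_imp, BoundedFormula.realize_inf, realize_mem',
    hM.realize_opairMemF, Fin.snoc_last, Fin.snoc_castSucc]
  refine ⟨fun h a b hab => ?_, fun h a b hab => ⟨fun c hc => ?_, fun c hc => ?_⟩⟩
  · obtain ⟨ha, hb⟩ := hM.mem_of_pair_mem (xs f).2 hab
    obtain ⟨h1, h2⟩ := h ⟨a, ha⟩ ⟨b, hb⟩ hab
    refine ⟨fun c hc hcs => ?_, fun c hc => ?_⟩
    · obtain ⟨d, hd, hcd⟩ := h1 ⟨c, hM.mem_of_mem ha hc⟩ ⟨hc, hcs⟩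
      exact ⟨d, hd, hcd⟩
    · obtain ⟨d, ⟨hd, hds⟩, hcd⟩ := h2 ⟨c, hM.mem_of_mem hb hc⟩ hc
      exact ⟨d, hd, hds, hcd⟩
  · obtain ⟨d, hd, hcd⟩ := (h a b hab).1 c hc.1 hc.2
    exact ⟨⟨d, hM.mem_of_mem b.2 hd⟩, hd, hcd⟩
  · obtain ⟨d, hd, hds, hcd⟩ := (h a b hab).2 c hc
    exact ⟨⟨d, hM.mem_of_mem a.2 hd⟩, ⟨hd, hds⟩, hcd⟩

end Realize

/-- Every element of a model of ZFC belongs to a transitive set of the model. -/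
theorem exists_isTransitive (hM : IsZFCModel M) {x : ZFSet} (hx : x ∈ M) :
    ∃ t ∈ M, t.IsTransitive ∧ x ∈ t := by
  induction x using ZFSet.inductionOn with
  | _ x ih =>
    let τ (n : ℕ) (t : Fin n) : ZFLang.BoundedFormula Empty n :=
      ∀' (mem' (Fin.last n) t.castSucc ⟹
        ∀' (mem' (Fin.last (n + 1)) (Fin.last n).castSucc ⟹
          mem' (Fin.last (n + 1)) t.castSucc.castSucc))
    have hτ {n : ℕ} (t : Fin n) (xs : Fin n → M) :
        (τ n t).Realize default xs ↔ (xs t : ZFSet).IsTransitive := by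
      simp only [τ, BoundedFormula.realize_all, BoundedFormula.realize_imp, realize_mem',
        Fin.snoc_last, Fin.snoc_castSucc]
      refine ⟨fun h y hy z hz => ?_, fun h y hy z hz => h _ hy hz⟩
      have hyM := hM.mem_of_mem (xs t).2 hy
      exact h ⟨y, hyM⟩ hy ⟨z, hM.mem_of_mem hyM hz⟩ hz
    obtain ⟨b, hb, h⟩ := hM.exists_coll (k := 0) (τ 2 1 ⊓ mem' 0 1) Fin.elim0 hx
      (P := fun y t => t.IsTransitive ∧ y ∈ t)
      (by simp [hτ, Fin.snoc])
      (fun y hy => ih y hy (hM.mem_of_mem hx hy))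
    have hb' := hM.sep_mem (k := 0) (τ 1 0) Fin.elim0 hb (P := ZFSet.IsTransitive)
      (by simp [hτ, Fin.snoc])
    have hu : (ZFSet.sUnion (b.sep ZFSet.IsTransitive)).IsTransitive :=
      ZFSet.IsTransitive.sUnion' fun y hy => (ZFSet.mem_sep.1 hy).2
    refine ⟨_, hM.union_mem (hM.sUnion_mem hb') (hM.singleton_mem hx), ?_, by simp⟩
    intro y hy z hz
    rw [ZFSet.mem_union, ZFSet.mem_singleton] at hy ⊢
    rcases hy with hy | rfl
    · exact .inl (hu y hy hz)
    · obtain ⟨t, htb, ht, hzt⟩ := h z hz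
      exact .inl (ZFSet.mem_sUnion.2 ⟨t, ZFSet.mem_sep.2 ⟨htb, ht⟩, hzt⟩)

end IsZFCModel

theorem IsBisim.sUnion {F s : ZFSet} (h : ∀ f ∈ F, IsBisim f s) : IsBisim F.sUnion s := by
  intro a b hab
  obtain ⟨f, hf, hab⟩ := ZFSet.mem_sUnion.1 hab
  obtain ⟨h1, h2⟩ := h f hf a b hab
  refine ⟨fun c hc hcs => ?_, fun c hc => ?_⟩
  · obtain ⟨d, hd, hcd⟩ := h1 c hc hcs
    exact ⟨d, hd, ZFSet.mem_sUnion.2 ⟨f, hf, hcd⟩⟩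
  · obtain ⟨d, hd, hds, hcd⟩ := h2 c hc
    exact ⟨d, hd, hds, ZFSet.mem_sUnion.2 ⟨f, hf, hcd⟩⟩

section Embedding

variable {M N : Set ZFSet} {j : M → N} {t s : ZFSet}

/-- A bisimulation on the pointwise image of a transitive set inverts the embedding. -/
theorem IsBisim.eq_of_pair_mem (hM : IsZFCModel M)
    (hj : ∀ x y : M, (j x : ZFSet) ∈ (j y : ZFSet) ↔ (x : ZFSet) ∈ (y : ZFSet))
    (ht : t.IsTransitive) (hs : ImageSet M N j t s)
    {f : ZFSet} (hf : IsBisim f s) {u : ZFSet} (huM : u ∈ M) (hut : u ∈ t) {v : ZFSet}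
    (huv : ZFSet.pair (j ⟨u, huM⟩) v ∈ f) : v = u := by
  induction u using ZFSet.inductionOn generalizing v with
  | _ u ih =>
    obtain ⟨h1, h2⟩ := hf _ _ huv
    ext z
    refine ⟨fun hz => ?_, fun hz => ?_⟩
    · obtain ⟨d, hdu, hds, hdz⟩ := h2 z hz
      obtain ⟨w, hwt, rfl⟩ := (hs d).1 hds
      have hwu := (hj w ⟨u, huM⟩).1 hdu
      exact ih w hwu w.2 hwt hdz ▸ hwu
    · have hzM := hM.mem_of_mem huM hz
      have hzt := ht u hut hz
      obtain ⟨d, hd, hzd⟩ := h1 (j ⟨z, hzM⟩) ((hj _ _).2 hz) ((hs _).2 ⟨⟨z, hzM⟩, hzt, rfl⟩)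
      exact ih z hz hzM hzt hzd ▸ hd

theorem exists_isBisim (hM : IsZFCModel M) (hN : IsZFCModel N)
    (hj : ∀ x y : M, (j x : ZFSet) ∈ (j y : ZFSet) ↔ (x : ZFSet) ∈ (y : ZFSet))
    (ht : t.IsTransitive) (hsN : s ∈ N) (hs : ImageSet M N j t s)
    {u : ZFSet} (huM : u ∈ M) (hut : u ∈ t) :
    ∃ f ∈ N, IsBisim f s ∧ ZFSet.pair (j ⟨u, huM⟩) u ∈ f := by
  induction u using ZFSet.inductionOn with
  | _ u ih =>
    let U : N := j ⟨u, huM⟩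
    have hUs : ∀ y ∈ (U : ZFSet), y ∈ s → ∃ z, ∃ hz : z ∈ M, z ∈ u ∧ z ∈ t ∧ j ⟨z, hz⟩ = y := by
      intro y hy hys
      obtain ⟨z, hzt, rfl⟩ := (hs y).1 hys
      exact ⟨z, z.2, (hj z ⟨u, huM⟩).1 hy, hzt, rfl⟩
    obtain ⟨B, hBN, hB⟩ := hN.exists_coll (k := 1)
      (mem' 1 0 ⟹ (bisimF 2 0 ⊓ ∃' opairMemF 1 3 2)) ![⟨s, hsN⟩] U.2
      (P := fun y f => y ∈ s → IsBisim f s ∧ ∃ v ∈ N, y.pair v ∈ f)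
      (by simp [hN.realize_bisimF, hN.realize_opairMemF])
      (by
        intro y hy
        by_cases hys : y ∈ s
        · obtain ⟨z, hzM, hzu, hzt, rfl⟩ := hUs y hy hys
          obtain ⟨f, hfN, hf, hzf⟩ := ih z hzu hzM hzt
          exact ⟨f, hfN, fun _ => ⟨hf, z, (hN.mem_of_pair_mem hfN hzf).2, hzf⟩⟩
        · exact ⟨s, hsN, fun h => (hys h).elim⟩)
    have hF := hN.sUnion_mem (hN.sep_mem (k := 1) (bisimF 1 0) ![⟨s, hsN⟩] hBN
      (P := fun f => IsBisim f s) (by simp [hN.realize_bisimF]))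
    set F := (B.sep fun f => IsBisim f s).sUnion
    have hFb : IsBisim F s := .sUnion fun f hf => (ZFSet.mem_sep.1 hf).2
    have hzF : ∀ z (hzM : z ∈ M), z ∈ u → ZFSet.pair (j ⟨z, hzM⟩) z ∈ F := by
      intro z hzM hzu
      have hzt := ht u hut hzu
      obtain ⟨f, hfB, h⟩ := hB (j ⟨z, hzM⟩) ((hj _ _).2 hzu)
      obtain ⟨hf, v, -, hv⟩ := h ((hs _).2 ⟨⟨z, hzM⟩, hzt, rfl⟩)
      have hvz := hf.eq_of_pair_mem hM hj ht hs hzM hzt hv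
      exact ZFSet.mem_sUnion.2 ⟨f, ZFSet.mem_sep.2 ⟨hfB, hf⟩, hvz ▸ hv⟩
    have huN : u ∈ N := by
      have := hN.sep_mem (k := 3) (∃' (mem' 4 1 ⊓ mem' 4 0 ⊓ opairMemF 4 3 2))
        ![⟨s, hsN⟩, U, ⟨F, hF⟩] (hN.sUnion_mem (hN.sUnion_mem hF))
        (P := fun v => ∃ y, (y ∈ (U : ZFSet) ∧ y ∈ s) ∧ y ∈ N ∧ y.pair v ∈ F)
        (by simp [hN.realize_opairMemF])
      convert this
      ext z
      rw [ZFSet.mem_sep]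
      refine ⟨fun hz => ?_, fun ⟨_, y, ⟨hyU, hys⟩, _, hyz⟩ => ?_⟩
      · have hzM := hM.mem_of_mem huM hz
        have hp := hzF z hzM hz
        refine ⟨?_, j ⟨z, hzM⟩, ⟨(hj _ _).2 hz,
          (hs _).2 ⟨⟨z, hzM⟩, ht u hut hz, rfl⟩⟩, Subtype.coe_prop _, hp⟩
        refine ZFSet.mem_sUnion.2 ⟨{(j ⟨z, hzM⟩ : ZFSet), z}, ZFSet.mem_sUnion.2 ⟨_, hp, ?_⟩, ?_⟩
        · simp [ZFSet.pair]
        · simp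
      · obtain ⟨w, hwM, hwu, hwt, rfl⟩ := hUs y hyU hys
        rwa [hFb.eq_of_pair_mem hM hj ht hs hwM hwt hyz]
    refine ⟨F ∪ {ZFSet.pair U u}, hN.union_mem hF (hN.singleton_mem (hN.pair_mem U.2 huN)), ?_,
      by simp [U]⟩
    intro a b hab
    simp only [ZFSet.mem_union, ZFSet.mem_singleton, ZFSet.pair_inj] at hab ⊢
    rcases hab with hab | ⟨rfl, rfl⟩
    · obtain ⟨h1, h2⟩ := hFb a b hab
      refine ⟨fun c hc hcs => ?_, fun c hc => ?_⟩
      · obtain ⟨d, hd, h⟩ := h1 c hc hcs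
        exact ⟨d, hd, .inl h⟩
      · obtain ⟨d, hd, hds, h⟩ := h2 c hc
        exact ⟨d, hd, hds, .inl h⟩
    · refine ⟨fun c hc hcs => ?_, fun c hc => ?_⟩
      · obtain ⟨z, hzM, hzu, -, rfl⟩ := hUs c hc hcs
        exact ⟨z, hzu, .inl (hzF z hzM hzu)⟩
      · have hcM := hM.mem_of_mem huM hc
        exact ⟨j ⟨c, hcM⟩, (hj _ _).2 hc, (hs _).2 ⟨⟨c, hcM⟩, ht _ hut hc, rfl⟩,
          .inl (hzF c hcM hc)⟩

end Embedding

/-- if `j : M → N` is an amenable elementary embedding between transitive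
models of ZFC with the same ordinals, then `M ⊆ N`. -/
theorem stmt4 (M N : Set ZFSet) (hM : IsZFCModel M) (hN : IsZFCModel N)
    (hOrd : SameOrdinals M N) (j : ↥M ↪ₑ[ZFLang] ↥N) (hj : Amenable M N ⇑j) :
    M ⊆ N := by
  intro x hx
  have hjm (x y : M) : (j x : ZFSet) ∈ (j y : ZFSet) ↔ (x : ZFSet) ∈ (y : ZFSet) :=
    j.map_rel memRel ![x, y]
  obtain ⟨t, htM, ht, hxt⟩ := hM.exists_isTransitive hx
  obtain ⟨s, hsN, hs⟩ := hj t htM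
  obtain ⟨f, hfN, -, hf⟩ := exists_isBisim hM hN hjm ht hsN hs hx hxt
  exact (hN.mem_of_pair_mem hfN hf).2
end
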